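/- Fuglede-type stability theorem for the Bergman ball in C^2 (unpacked form). For every r0 > 0 there exist eps0 in (0, 1/2] and c1 > 0 with the following property. Let r in (0, r0] and let u : S -> R be a C^1 function with |u(w)| <= eps0 and ||grad_tau u(w)|| <= eps0 for every w in S, satisfying the volume constraint Int_S sinh^4( r(1+u(w))/2 ) dH(w) = sinh^4(r/2) * H(S) and the barycenter constraint Int_S w * (1+u(w)) * ( Int_0^r sinh^4( rho(1+u(w))/2 ) d rho ) dH(w) = 0 (an identity in C^2). Define for w in S: t(w) = tanh( r(1+u(w))/2 ), t0 = tanh(r/2), x(w) = ||grad_tau u(w)||^2, s(w) = ( Re< grad_tau u(w), i*w > )^2, R(w) = 4 / ( r^2 (1 - t(w)^2)^2 ), and set P(E) = Int_S t^3 (1-t^2)^{-5/2} * sqrt( 1 - t^2 (R+s)/(R+x) ) * sqrt( 1 + r^2 (1-t^2)^2 x / (4 t^2) ) dH, P(B_r) = t0^3 (1-t0^2)^{-2} * H(S). Then P(E) - P(B_r) >= c1 * P(B_r) * ( Int_S ( ||grad_tau u||^2 + u^2 ) dH ). -/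

import Mathlib

open MeasureTheory Real

noncomputable section

instance : MeasurableSpace (EuclideanSpace ℂ (Fin 2)) := borel _
instance : BorelSpace (EuclideanSpace ℂ (Fin 2)) := ⟨rfl⟩

set_option linter.unusedSimpArgs false

namespace FB

open MvPolynomial in
/-- the polynomial ring in four real variables -/
abbrev Pol := MvPolynomial (Fin 4) ℝ

/-- the three rotation derivations -/
def D1 : Derivation ℝ Pol Pol := MvPolynomial.mkDerivation ℝ
  ![-MvPolynomial.X 1, MvPolynomial.X 0, -MvPolynomial.X 3, MvPolynomial.X 2]
def D2 : Derivation ℝ Pol Pol := MvPolynomial.mkDerivation ℝ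
  ![-MvPolynomial.X 2, MvPolynomial.X 3, MvPolynomial.X 0, -MvPolynomial.X 1]
def D3 : Derivation ℝ Pol Pol := MvPolynomial.mkDerivation ℝ
  ![-MvPolynomial.X 3, -MvPolynomial.X 2, MvPolynomial.X 1, MvPolynomial.X 0]

open MvPolynomial

def rho : Pol := X 0 ^ 2 + X 1 ^ 2 + X 2 ^ 2 + X 3 ^ 2

def Iid : Ideal Pol := Ideal.span {rho - 1}

/-- degree filtration -/
def W : ℕ → Submodule ℝ Pol
  | 0 => Submodule.span ℝ {1}
  | (k+1) => W k ⊔ ⨆ i : Fin 4, (W k).map (LinearMap.mulLeft ℝ (X i : Pol))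

lemma W_mono_succ (k : ℕ) : W k ≤ W (k+1) := le_sup_left

lemma W_mono {k l : ℕ} (h : k ≤ l) : W k ≤ W l := monotone_nat_of_le_succ W_mono_succ h

lemma W_mulX {k : ℕ} {p : Pol} (hp : p ∈ W k) (i : Fin 4) : X i * p ∈ W (k+1) := by
  apply Submodule.mem_sup_right
  exact Submodule.mem_iSup_of_mem i ⟨p, hp, rfl⟩

lemma W_fg (k : ℕ) : (W k).FG := by
  induction k with
  | zero => exact Submodule.fg_span_singleton 1
  | succ k ih => exact ih.sup (Submodule.fg_iSup _ (fun i => ih.map _))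

/-- induction principle -/
lemma W_ind {motive : ℕ → Pol → Prop}
    (hadd : ∀ k p q, motive k p → motive k q → motive k (p+q))
    (hC : ∀ c, motive 0 (C c))
    (hm : ∀ k p, p ∈ W k → motive k p → motive (k+1) p)
    (hX : ∀ k p i, p ∈ W k → motive k p → motive (k+1) (X i * p)) :
    ∀ k p, p ∈ W k → motive k p := by
  intro k
  induction k with
  | zero =>
    intro p hp
    obtain ⟨c, rfl⟩ := Submodule.mem_span_singleton.1 hp
    rw [MvPolynomial.smul_eq_C_mul, mul_one]; exact hC c
  | succ k ih =>
    intro p hp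
    obtain ⟨a, ha, b, hb, rfl⟩ := Submodule.mem_sup.1 hp
    refine hadd _ _ _ (hm _ _ ha (ih a ha)) ?_
    refine Submodule.iSup_induction _ (motive := fun b => motive (k+1) b) hb ?_ ?_ ?_
    · rintro i x ⟨y, hy, rfl⟩
      exact hX k y i hy (ih y hy)
    · have := hm k 0 (zero_mem _) (ih 0 (zero_mem _))
      exact this
    · intro x y; exact hadd _ x y

lemma C_mem_W (k : ℕ) (c : ℝ) : C c ∈ W k := by
  apply W_mono (Nat.zero_le k)
  apply Submodule.mem_span_singleton.2
  exact ⟨c, by rw [MvPolynomial.smul_eq_C_mul, mul_one]⟩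

lemma W_exhaust (p : Pol) : ∃ k, p ∈ W k := by
  induction p using MvPolynomial.induction_on with
  | C a => exact ⟨0, C_mem_W 0 a⟩
  | add p q hp hq =>
    obtain ⟨k, hk⟩ := hp
    obtain ⟨l, hl⟩ := hq
    exact ⟨max k l, add_mem (W_mono (le_max_left _ _) hk) (W_mono (le_max_right _ _) hl)⟩
  | mul_X p i hp =>
    obtain ⟨k, hk⟩ := hp
    exact ⟨k+1, by rw [mul_comm]; exact W_mulX hk i⟩

lemma X_mem_W1 (i : Fin 4) : (X i : Pol) ∈ W 1 := by
  have := W_mulX (C_mem_W 0 1) i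
  simpa using this

lemma der_mem_W (D : Derivation ℝ Pol Pol)
    (hD : ∀ i, ∃ s : ℝ, ∃ j, D (X i) = C s * X j) :
    ∀ k p, p ∈ W k → D p ∈ W k := by
  apply W_ind
  · intro k p q hp hq; rw [map_add]; exact add_mem hp hq
  · intro c; rw [MvPolynomial.derivation_C]; exact zero_mem _
  · intro k p _ h; exact W_mono_succ k h
  · intro k p i hp h
    rw [Derivation.leibniz, smul_eq_mul, smul_eq_mul]
    obtain ⟨s, j, hs⟩ := hD i
    refine add_mem (W_mulX h i) ?_
    rw [hs, show p * (C s * X j) = s • (X j * p) by rw [MvPolynomial.smul_eq_C_mul]; ring]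
    exact Submodule.smul_mem _ _ (W_mulX hp j)

lemma D1_X (i : Fin 4) : D1 (X i) = (![-X 1, X 0, -X 3, X 2] : Fin 4 → Pol) i := mkDerivation_X _ _ _
lemma D2_X (i : Fin 4) : D2 (X i) = (![-X 2, X 3, X 0, -X 1] : Fin 4 → Pol) i := mkDerivation_X _ _ _
lemma D3_X (i : Fin 4) : D3 (X i) = (![-X 3, -X 2, X 1, X 0] : Fin 4 → Pol) i := mkDerivation_X _ _ _

lemma D1_W : ∀ k p, p ∈ W k → D1 p ∈ W k := by
  apply der_mem_W
  intro i; fin_cases i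
  · exact ⟨-1, 1, by simp [D1_X]⟩
  · exact ⟨1, 0, by simp [D1_X]⟩
  · exact ⟨-1, 3, by simp [D1_X]⟩
  · exact ⟨1, 2, by simp [D1_X]⟩
lemma D2_W : ∀ k p, p ∈ W k → D2 p ∈ W k := by
  apply der_mem_W
  intro i; fin_cases i
  · exact ⟨-1, 2, by simp [D2_X]⟩
  · exact ⟨1, 3, by simp [D2_X]⟩
  · exact ⟨1, 0, by simp [D2_X]⟩
  · exact ⟨-1, 1, by simp [D2_X]⟩
lemma D3_W : ∀ k p, p ∈ W k → D3 p ∈ W k := by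
  apply der_mem_W
  intro i; fin_cases i
  · exact ⟨-1, 3, by simp [D3_X]⟩
  · exact ⟨-1, 2, by simp [D3_X]⟩
  · exact ⟨1, 1, by simp [D3_X]⟩
  · exact ⟨1, 0, by simp [D3_X]⟩

lemma comm23 (p : Pol) : D2 (D3 p) - D3 (D2 p) = - (D1 p + D1 p) := by
  have : ⁅D2, D3⁆ = -(D1 + D1) := by
    apply MvPolynomial.derivation_ext
    intro i
    rw [Derivation.commutator_apply, Derivation.neg_apply, Derivation.add_apply, D1_X, D2_X, D3_X]
    fin_cases i <;> simp [D1_X, D2_X, D3_X] <;> ring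
  have h := congrArg (fun D : Derivation ℝ Pol Pol => D p) this
  simpa only [Derivation.commutator_apply, Derivation.neg_apply, Derivation.add_apply] using h

lemma comm12 (p : Pol) : D1 (D2 p) - D2 (D1 p) = - (D3 p + D3 p) := by
  have : ⁅D1, D2⁆ = -(D3 + D3) := by
    apply MvPolynomial.derivation_ext
    intro i
    rw [Derivation.commutator_apply, Derivation.neg_apply, Derivation.add_apply, D1_X, D2_X, D3_X]
    fin_cases i <;> simp [D1_X, D2_X, D3_X] <;> ring
  have h := congrArg (fun D : Derivation ℝ Pol Pol => D p) this
  simpa only [Derivation.commutator_apply, Derivation.neg_apply, Derivation.add_apply] using h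

lemma comm31 (p : Pol) : D3 (D1 p) - D1 (D3 p) = - (D2 p + D2 p) := by
  have : ⁅D3, D1⁆ = -(D2 + D2) := by
    apply MvPolynomial.derivation_ext
    intro i
    rw [Derivation.commutator_apply, Derivation.neg_apply, Derivation.add_apply, D1_X, D2_X, D3_X]
    fin_cases i <;> simp [D1_X, D2_X, D3_X] <;> ring
  have h := congrArg (fun D : Derivation ℝ Pol Pol => D p) this
  simpa only [Derivation.commutator_apply, Derivation.neg_apply, Derivation.add_apply] using h

def Lap (p : Pol) : Pol := D1 (D1 p) + D2 (D2 p) + D3 (D3 p)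

lemma Lap_D1 (p : Pol) : Lap (D1 p) = D1 (Lap p) := by
  unfold Lap
  rw [map_add, map_add]
  have a2 := comm12 p
  have a3 := comm31 p
  have b2 := comm12 (D2 p)
  have b3 := comm31 (D3 p)
  have c2 := congrArg D2 a2
  have c3 := congrArg D3 a3
  rw [map_sub, map_neg, map_add] at c2 c3
  linear_combination -c2 - b2 + c3 + b3

def Gam (p q : Pol) : Pol := D1 p * D1 q + D2 p * D2 q + D3 p * D3 q

lemma Gam_XX (i j : Fin 4) : Gam (X i) (X j) = (if i = j then rho else 0) - X i * X j := by
  unfold Gam rho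
  rw [D1_X, D2_X, D3_X, D1_X, D2_X, D3_X]
  fin_cases i <;> fin_cases j <;> simp <;> ring

lemma Lap_X (i : Fin 4) : Lap (X i) = -3 * X i := by
  unfold Lap
  rw [D1_X, D2_X, D3_X]
  fin_cases i <;> simp [D1_X, D2_X, D3_X] <;> ring

lemma Gam_mul (l m g : Pol) : Gam l (m * g) = m * Gam l g + g * Gam l m := by
  unfold Gam
  simp only [Derivation.leibniz, smul_eq_mul]; ring

lemma Lap_mul (l g : Pol) : Lap (l * g) = l * Lap g + 2 * Gam l g + g * Lap l := by
  unfold Lap Gam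
  simp only [Derivation.leibniz, smul_eq_mul, map_add]; ring

/-- `W k` modulo the ideal of the sphere -/
def W' (k : ℕ) : Submodule ℝ Pol := W k ⊔ Iid.restrictScalars ℝ

lemma W'_mono {k l : ℕ} (h : k ≤ l) : W' k ≤ W' l := sup_le_sup_right (W_mono h) _
lemma W_le_W' (k : ℕ) : W k ≤ W' k := le_sup_left

lemma W'_mulX {k : ℕ} {p : Pol} (hp : p ∈ W' k) (i : Fin 4) : X i * p ∈ W' (k+1) := by
  obtain ⟨a, ha, b, hb, rfl⟩ := Submodule.mem_sup.1 hp
  rw [mul_add]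
  refine add_mem (Submodule.mem_sup_left (W_mulX ha i)) (Submodule.mem_sup_right ?_)
  exact Iid.mul_mem_left _ hb

lemma rho_mul_mem {k : ℕ} {p : Pol} (hp : p ∈ W k) : rho * p ∈ W' k := by
  have : rho * p = p + (rho - 1) * p := by ring
  rw [this]
  refine add_mem (W_le_W' k hp) (Submodule.mem_sup_right ?_)
  exact Iid.mul_mem_right _ (Ideal.subset_span rfl)

lemma Gam_add (l p q : Pol) : Gam l (p+q) = Gam l p + Gam l q := by
  unfold Gam; simp only [map_add]; ring
lemma Lap_add (p q : Pol) : Lap (p+q) = Lap p + Lap q := by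
  unfold Lap; simp only [map_add]; ring

lemma Gam_W (l : Fin 4) : ∀ k p, p ∈ W k → Gam (X l) p + (k : Pol) * (X l * p) ∈ W' k := by
  apply W_ind
  · intro k p q hp hq
    rw [Gam_add]
    have := add_mem hp hq
    convert this using 1; ring
  · intro c
    simp [Gam]
  · intro k p hp h
    have h2 := W_le_W' _ (W_mulX hp l)
    have := add_mem (W'_mono (Nat.le_succ k) h) h2
    convert this using 1; push_cast; ring
  · intro k p i hp h
    rw [Gam_mul, Gam_XX]
    have h1 := W'_mulX h i
    have h2 : p * (if l = i then rho else 0) ∈ W' (k+1) := by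
      split_ifs
      · rw [mul_comm]; exact W'_mono (Nat.le_succ k) (rho_mul_mem hp)
      · simp
    have := add_mem h1 h2
    convert this using 1; push_cast; ring

lemma natCast_mul_mem {k n : ℕ} {p : Pol} (hp : p ∈ W' k) : (n : Pol) * p ∈ W' k := by
  rw [← nsmul_eq_mul]; exact nsmul_mem hp n

lemma Lap_W0 : ∀ p ∈ W 0, Lap p = 0 := by
  intro p hp
  obtain ⟨c, rfl⟩ := Submodule.mem_span_singleton.1 hp
  simp [Lap]

lemma Lap_mem (k : ℕ) (p : Pol) (hp : p ∈ W k) : Lap p ∈ W k :=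
  add_mem (add_mem (D1_W _ _ (D1_W _ _ hp)) (D2_W _ _ (D2_W _ _ hp))) (D3_W _ _ (D3_W _ _ hp))

/-- Laplacian is upper triangular w.r.t. the filtration. -/
lemma Lap_W : ∀ k p, p ∈ W k → (k = 0 → Lap p = 0) ∧
    Lap p + ((k * (k+2) : ℕ) : Pol) * p ∈ W' (k - 1) := by
  apply W_ind
  · intro k p q hp hq
    rw [Lap_add]
    refine ⟨fun h => by rw [hp.1 h, hq.1 h, add_zero], ?_⟩
    have := add_mem hp.2 hq.2
    convert this using 1; ring
  · intro c
    simp [Lap]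
  · intro k p hp h
    refine ⟨fun h => by omega, ?_⟩
    rw [Nat.add_sub_cancel]
    exact add_mem (W_le_W' _ (Lap_mem _ _ hp)) (natCast_mul_mem (W_le_W' _ hp))
  · intro k p i hp h
    refine ⟨fun h => by omega, ?_⟩
    rw [Nat.add_sub_cancel, Lap_mul, Lap_X]
    have h1 : X i * (Lap p + ((k * (k+2) : ℕ) : Pol) * p) ∈ W' k := by
      rcases Nat.eq_zero_or_pos k with hk | hk
      · rw [h.1 hk, hk]; simp
      · have := W'_mulX h.2 i
        rwa [Nat.sub_add_cancel hk] at this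
    have h2 := natCast_mul_mem (n := 2) (Gam_W i k p hp)
    have := add_mem h1 h2
    convert this using 1; push_cast; ring

end FB

namespace FB
open MvPolynomial

section Hilb
variable {H : Type*} [NormedAddCommGroup H] [InnerProductSpace ℝ H]

lemma exists_proj (φ : Pol →ₗ[ℝ] H) (N : ℕ) (h : H) :
    ∃ P ∈ W N, ∀ Q ∈ W N, inner ℝ (h - φ P) (φ Q) = 0 := by
  have hfg : ((W N).map φ).FG := (W_fg N).map _
  have : FiniteDimensional ℝ ((W N).map φ) := Module.Finite.iff_fg.2 hfg
  obtain ⟨P, hP, hPe⟩ := (((W N).map φ).orthogonalProjectionOnto h).2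
  refine ⟨P, hP, fun Q hQ => ?_⟩
  rw [hPe]
  exact Submodule.starProjection_inner_eq_zero h (φ Q) ⟨Q, hQ, rfl⟩

/-- antisymmetry of a derivation in the Hilbert space -/
def Anti (φ : Pol →ₗ[ℝ] H) (D : Derivation ℝ Pol Pol) : Prop :=
  ∀ p q, inner ℝ (φ (D p)) (φ q) = - inner ℝ (φ p) (φ (D q))

lemma Anti.normsq {φ : Pol →ₗ[ℝ] H} {D : Derivation ℝ Pol Pol} (h : Anti φ D) (p : Pol) :
    ‖φ (D p)‖ ^ 2 = - inner ℝ (φ (D (D p))) (φ p) := by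
  rw [h, neg_neg, real_inner_self_eq_norm_sq]

lemma Anti.ker {φ : Pol →ₗ[ℝ] H} {D : Derivation ℝ Pol Pol} (h : Anti φ D) {p : Pol}
    (hp : φ p = 0) : φ (D p) = 0 := by
  have := h.normsq p
  rw [hp, inner_zero_right, neg_zero] at this
  simpa using this

lemma Anti.split {φ : Pol →ₗ[ℝ] H} {D : Derivation ℝ Pol Pol} (h : Anti φ D) {P Q : Pol}
    (hPQ : inner ℝ (φ Q) (φ (D (D P))) = 0) :
    ‖φ (D (P + Q))‖ ^ 2 = ‖φ (D P)‖ ^ 2 + ‖φ (D Q)‖ ^ 2 := by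
  rw [map_add, map_add, norm_add_sq_real, real_inner_comm, h, hPQ]; ring

lemma real_ineq (l a0 a1 a2 b : ℝ) (hl : 8 ≤ l) (h0 : 0 ≤ a0) (h1 : 0 ≤ a1)
    (hb : b = l * a0 - a1) (hb0 : 0 ≤ b) (hcs : a1 ^ 2 ≤ a0 * a2)
    (hm : 4 * a1 ^ 2 ≤ (l * a1 - a2) * b) : 2 * a0 ≤ b := by
  by_contra hlt
  push Not at hlt
  have ha0 : 0 < a0 := by linarith
  have ha1 : 0 < a1 := by nlinarith
  have k1 : a0 * (4 * a1 ^ 2) ≤ a1 * b * b := by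
    calc a0 * (4 * a1 ^ 2) ≤ a0 * ((l * a1 - a2) * b) := by gcongr
      _ = (l * a0 * a1 - a0 * a2) * b := by ring
      _ ≤ (l * a0 * a1 - a1 ^ 2) * b := by gcongr
      _ = a1 * b * b := by rw [hb]; ring
  have k2 : 4 * a0 * a1 ≤ b * b := by
    have : a1 * (4 * a0 * a1) ≤ a1 * (b * b) := by nlinarith
    exact le_of_mul_le_mul_left this ha1
  have k3 : 6 * a0 < a1 := by nlinarith
  nlinarith

lemma cs2 (a b c d : H) : (inner ℝ a b - inner ℝ c d) ^ 2 ≤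
    (‖a‖ ^ 2 + ‖c‖ ^ 2) * (‖b‖ ^ 2 + ‖d‖ ^ 2) := by
  have h1 := abs_real_inner_le_norm a b
  have h2 := abs_real_inner_le_norm c d
  have h3 : |inner ℝ a b - inner ℝ c d| ≤ ‖a‖ * ‖b‖ + ‖c‖ * ‖d‖ :=
    (abs_sub _ _).trans (add_le_add h1 h2)
  have h4 : (inner ℝ a b - inner ℝ c d) ^ 2 ≤ (‖a‖ * ‖b‖ + ‖c‖ * ‖d‖) ^ 2 := by
    rw [← sq_abs]; gcongr
  nlinarith [sq_nonneg (‖a‖ * ‖d‖ - ‖c‖ * ‖b‖)]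

lemma eigen_est {φ : Pol →ₗ[ℝ] H} (h1 : Anti φ D1) (h2 : Anti φ D2) (h3 : Anti φ D3)
    {P : Pol} {l : ℝ} (hl : 8 ≤ l) (hP : φ (Lap P + C l * P) = 0) :
    8 * ‖φ P‖ ^ 2 ≤ ‖φ (D1 P)‖ ^ 2 + ‖φ (D2 P)‖ ^ 2 + ‖φ (D3 P)‖ ^ 2 ∧
    2 * ‖φ P‖ ^ 2 ≤ ‖φ (D2 P)‖ ^ 2 + ‖φ (D3 P)‖ ^ 2 := by
  have key : ∀ Q : Pol, φ (Lap Q + C l * Q) = 0 →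
      ‖φ (D1 Q)‖ ^ 2 + ‖φ (D2 Q)‖ ^ 2 + ‖φ (D3 Q)‖ ^ 2 = l * ‖φ Q‖ ^ 2 := by
    intro Q hQ
    rw [h1.normsq, h2.normsq, h3.normsq]
    rw [← MvPolynomial.smul_eq_C_mul, map_add, map_smul] at hQ
    have : inner ℝ (φ (Lap Q) + l • φ Q) (φ Q) = 0 := by rw [hQ, inner_zero_left]
    rw [inner_add_left, real_inner_smul_left, real_inner_self_eq_norm_sq, Lap, map_add, map_add,
      inner_add_left, inner_add_left] at this
    linarith
  have e1 := key P hP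
  have hP' : φ (Lap (D1 P) + C l * D1 P) = 0 := by
    have := h1.ker hP
    rw [map_add, ← MvPolynomial.smul_eq_C_mul, Derivation.map_smul, MvPolynomial.smul_eq_C_mul,
      ← Lap_D1] at this
    exact this
  have e2 := key (D1 P) hP'
  refine ⟨by rw [e1]; gcongr, ?_⟩
  apply real_ineq l (‖φ P‖^2) (‖φ (D1 P)‖^2) (‖φ (D1 (D1 P))‖^2) _ hl (by positivity)
    (by positivity) (by linarith) (by positivity)
  · have := h1.normsq P
    have h5 := abs_real_inner_le_norm (φ (D1 (D1 P))) (φ P)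
    rw [this, neg_sq, ← sq_abs, ← mul_pow]
    gcongr
    linarith
  · have hc : 2 * ‖φ (D1 P)‖ ^ 2 = inner ℝ (φ (D2 (D1 P))) (φ (D3 P))
        - inner ℝ (φ (D3 (D1 P))) (φ (D2 P)) := by
      rw [h2, h3]
      have := congrArg φ (comm23 P)
      have h6 : inner ℝ (φ (D1 P)) (φ (D2 (D3 P) - D3 (D2 P))) = - 2 * ‖φ (D1 P)‖^2 := by
        rw [this, map_neg, map_add, inner_neg_right, inner_add_right, real_inner_self_eq_norm_sq]
        ring
      rw [map_sub, inner_sub_right] at h6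
      linarith
    have := cs2 (φ (D2 (D1 P))) (φ (D3 P)) (φ (D3 (D1 P))) (φ (D2 P))
    rw [← hc] at this
    have e3 : l * ‖φ (D1 P)‖ ^ 2 - ‖φ (D1 (D1 P))‖ ^ 2 =
      ‖φ (D2 (D1 P))‖ ^ 2 + ‖φ (D3 (D1 P))‖ ^ 2 := by linarith
    rw [e3]
    nlinarith

lemma gap_poly {φ : Pol →ₗ[ℝ] H} (hI : ∀ p ∈ Iid, φ p = 0)
    (h1 : Anti φ D1) (h2 : Anti φ D2) (h3 : Anti φ D3) :
    ∀ n : ℕ, ∀ P ∈ W (n+1), (∀ Q ∈ W 1, inner ℝ (φ P) (φ Q) = 0) →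
    8 * ‖φ P‖ ^ 2 ≤ ‖φ (D1 P)‖ ^ 2 + ‖φ (D2 P)‖ ^ 2 + ‖φ (D3 P)‖ ^ 2 ∧
    2 * ‖φ P‖ ^ 2 ≤ ‖φ (D2 P)‖ ^ 2 + ‖φ (D3 P)‖ ^ 2 := by
  intro n
  induction n with
  | zero =>
    intro P hP hQ
    have h0 : ‖φ P‖ ^ 2 = 0 := by rw [← real_inner_self_eq_norm_sq]; exact hQ P hP
    rw [h0]; constructor <;> (rw [mul_zero]; positivity)
  | succ n ih =>
    intro P hP hPo
    obtain ⟨A, hA, hAo⟩ := exists_proj φ (n+1) (φ P)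
    obtain ⟨B, hB⟩ : ∃ B, B = P - A := ⟨_, rfl⟩
    have hBW : B ∈ W (n+1+1) := by rw [hB]; exact sub_mem hP (W_mono_succ _ hA)
    have hBo : ∀ Q ∈ W (n+1), inner ℝ (φ B) (φ Q) = 0 := by
      intro Q hQ; rw [hB, map_sub]; exact hAo Q hQ
    have hPAB : P = A + B := by rw [hB]; ring
    have hA1 : ∀ Q ∈ W 1, inner ℝ (φ A) (φ Q) = 0 := by
      intro Q hQ
      have e1 := hPo Q hQ
      have e2 := hBo Q (W_mono (by omega) hQ)
      rw [hPAB, map_add, inner_add_left, e2, add_zero] at e1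
      exact e1
    have ihA := ih A hA hA1
    -- eigenvalue equation for B
    have hlam := (Lap_W (n+1+1) B hBW).2
    rw [Nat.add_sub_cancel] at hlam
    obtain ⟨G, hG, J, hJ, hGJ⟩ := Submodule.mem_sup.1 hlam
    set l : ℝ := (((n+1+1) * (n+1+1+2) : ℕ) : ℝ) with hl
    have hl8 : 8 ≤ l := by
      rw [hl]; exact_mod_cast (by nlinarith : 8 ≤ (n+1+1) * (n+1+1+2))
    have hcast : (((n+1+1) * (n+1+1+2) : ℕ) : Pol) = C l := by rw [hl, map_natCast]
    rw [hcast] at hGJ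
    have hGe : φ (Lap B + C l * B) = φ G := by rw [← hGJ, map_add, hI J hJ, add_zero]
    have hBeig : φ (Lap B + C l * B) = 0 := by
      have : inner ℝ (φ (Lap B + C l * B)) (φ G) = 0 := by
        rw [← MvPolynomial.smul_eq_C_mul, map_add, map_smul, inner_add_left, real_inner_smul_left,
          hBo G hG, mul_zero, add_zero, Lap, map_add, map_add, inner_add_left, inner_add_left,
          h1, h1, h2, h2, h3, h3,
          hBo _ (D1_W _ _ (D1_W _ _ hG)), hBo _ (D2_W _ _ (D2_W _ _ hG)),
          hBo _ (D3_W _ _ (D3_W _ _ hG))]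
        simp
      rw [hGe] at this ⊢
      simpa using this
    have hBest := eigen_est h1 h2 h3 hl8 hBeig
    have s0 : ‖φ P‖ ^ 2 = ‖φ A‖ ^ 2 + ‖φ B‖ ^ 2 := by
      rw [hPAB, map_add, norm_add_sq_real, real_inner_comm, hBo A hA]; ring
    have s1 := h1.split (hBo _ (D1_W _ _ (D1_W _ _ hA)))
    have s2 := h2.split (hBo _ (D2_W _ _ (D2_W _ _ hA)))
    have s3 := h3.split (hBo _ (D3_W _ _ (D3_W _ _ hA)))
    rw [← hPAB] at s1 s2 s3
    rw [s0, s1, s2, s3]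
    constructor <;> linarith [ihA.1, ihA.2, hBest.1, hBest.2]

/-- Abstract spectral gap. -/
theorem gap_abstract {φ : Pol →ₗ[ℝ] H} (hI : ∀ p ∈ Iid, φ p = 0)
    (h1 : Anti φ D1) (h2 : Anti φ D2) (h3 : Anti φ D3)
    (U g1 g2 g3 : H)
    (w1 : ∀ p, inner ℝ g1 (φ p) = - inner ℝ U (φ (D1 p)))
    (w2 : ∀ p, inner ℝ g2 (φ p) = - inner ℝ U (φ (D2 p)))
    (w3 : ∀ p, inner ℝ g3 (φ p) = - inner ℝ U (φ (D3 p)))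
    (hdense : ∀ ε > 0, ∃ p, ‖U - φ p‖ < ε)
    (P1 : Pol) (hP1 : P1 ∈ W 1) (hP1o : ∀ Q ∈ W 1, inner ℝ (U - φ P1) (φ Q) = 0) :
    8 * (‖U‖ ^ 2 - ‖φ P1‖ ^ 2) ≤ ‖g1‖ ^ 2 + ‖g2‖ ^ 2 + ‖g3‖ ^ 2 ∧
    2 * (‖U‖ ^ 2 - ‖φ P1‖ ^ 2) ≤ ‖g2‖ ^ 2 + ‖g3‖ ^ 2 := by
  have main : ∀ ε > 0, 8 * (‖U‖ ^ 2 - ε ^ 2 - ‖φ P1‖ ^ 2) ≤ ‖g1‖ ^ 2 + ‖g2‖ ^ 2 + ‖g3‖ ^ 2 ∧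
    2 * (‖U‖ ^ 2 - ε ^ 2 - ‖φ P1‖ ^ 2) ≤ ‖g2‖ ^ 2 + ‖g3‖ ^ 2 := by
    intro ε hε
    obtain ⟨R, hR⟩ := hdense ε hε
    obtain ⟨k, hk⟩ := W_exhaust R
    have hk' : R ∈ W (k+1) := W_mono_succ _ hk
    obtain ⟨P, hP, hPo⟩ := exists_proj φ (k+1) U
    have hdist : ‖U - φ P‖ ^ 2 ≤ ε ^ 2 := by
      have e : ‖U - φ R‖ ^ 2 = ‖U - φ P‖ ^ 2 + ‖φ (P - R)‖ ^ 2 := by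
        rw [show U - φ R = (U - φ P) + φ (P - R) by rw [map_sub]; abel, norm_add_sq_real,
          hPo _ (sub_mem hP hk')]; ring
      have : ‖U - φ R‖ ^ 2 ≤ ε ^ 2 := by gcongr
      nlinarith [sq_nonneg ‖φ (P - R)‖]
    have hUn : ‖U‖ ^ 2 = ‖U - φ P‖ ^ 2 + ‖φ P‖ ^ 2 := by
      conv_lhs => rw [show U = (U - φ P) + φ P by abel, norm_add_sq_real, hPo _ hP]
      ring
    have gest : ∀ (g : H) (D : Derivation ℝ Pol Pol), Anti φ D →
        (∀ k p, p ∈ W k → D p ∈ W k) →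
        (∀ p, inner ℝ g (φ p) = - inner ℝ U (φ (D p))) → ‖φ (D P)‖ ^ 2 ≤ ‖g‖ ^ 2 := by
      intro g D hD hDW hw
      have e1 := hw (D P)
      have e2 := hPo _ (hDW _ _ (hDW _ _ hP))
      have e3 := hD P (D P)
      rw [real_inner_self_eq_norm_sq] at e3
      rw [inner_sub_left] at e2
      have e4 : inner ℝ g (φ (D P)) = ‖φ (D P)‖ ^ 2 := by linarith
      have e5 : ‖g - φ (D P)‖ ^ 2 = ‖g‖ ^ 2 - 2 * inner ℝ g (φ (D P)) + ‖φ (D P)‖ ^ 2 :=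
        norm_sub_sq_real _ _
      nlinarith [sq_nonneg ‖g - φ (D P)‖]
    have q1 := gest g1 D1 h1 D1_W w1
    have q2 := gest g2 D2 h2 D2_W w2
    have q3 := gest g3 D3 h3 D3_W w3
    obtain ⟨B, hB⟩ : ∃ B, B = P - P1 := ⟨_, rfl⟩
    have hPB : P = P1 + B := by rw [hB]; ring
    have hBo : ∀ Q ∈ W 1, inner ℝ (φ B) (φ Q) = 0 := by
      intro Q hQ
      have e1 := hP1o Q hQ
      have e2 := hPo Q (W_mono (by omega) hQ)
      rw [hB, map_sub, show φ P - φ P1 = (U - φ P1) - (U - φ P) by abel, inner_sub_left, e1, e2,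
        sub_zero]
    have hBW : B ∈ W (k+1) := by rw [hB]; exact sub_mem hP (W_mono (by omega) hP1)
    have hg := gap_poly hI h1 h2 h3 k B hBW hBo
    have s0 : ‖φ P‖ ^ 2 = ‖φ P1‖ ^ 2 + ‖φ B‖ ^ 2 := by
      rw [hPB, map_add, norm_add_sq_real, real_inner_comm, hBo _ hP1]; ring
    have s1 := h1.split (hBo _ (D1_W _ _ (D1_W _ _ hP1)))
    have s2 := h2.split (hBo _ (D2_W _ _ (D2_W _ _ hP1)))
    have s3 := h3.split (hBo _ (D3_W _ _ (D3_W _ _ hP1)))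
    rw [← hPB] at s1 s2 s3
    have n1 := sq_nonneg ‖φ (D1 P1)‖
    have n2 := sq_nonneg ‖φ (D2 P1)‖
    have n3 := sq_nonneg ‖φ (D3 P1)‖
    constructor <;> linarith [hg.1, hg.2]
  constructor
  · apply le_of_forall_pos_le_add
    intro δ hδ
    have := (main (Real.sqrt (δ/8)) (by positivity)).1
    rw [Real.sq_sqrt (by positivity)] at this
    linarith
  · apply le_of_forall_pos_le_add
    intro δ hδ
    have := (main (Real.sqrt (δ/8)) (by positivity)).2
    rw [Real.sq_sqrt (by positivity)] at this
    linarith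

end Hilb
end FB

namespace FB
abbrev E := EuclideanSpace ℂ (Fin 2)
abbrev SS : Set E := Metric.sphere (0 : E) 1

def mu : Measure E := (μH[3] : Measure E).restrict SS

lemma sphere_iff (w : E) : w ∈ SS ↔ ‖w 0‖ ^ 2 + ‖w 1‖ ^ 2 = 1 := by
  rw [mem_sphere_zero_iff_norm, EuclideanSpace.norm_eq, Real.sqrt_eq_one, Fin.sum_univ_two]

def Psi (y : Fin 3 → ℝ) : E :=
  WithLp.toLp 2 ![(Real.cos (y 0) : ℂ) * Complex.exp ((y 1 : ℂ) * Complex.I),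
    (Real.sin (y 0) : ℂ) * Complex.exp ((y 2 : ℂ) * Complex.I)]

lemma Psi_contDiff : ContDiff ℝ 1 Psi := by
  have hof : ContDiff ℝ 1 (fun x : ℝ => (x : ℂ)) := Complex.ofRealCLM.contDiff
  have hap : ∀ i : Fin 3, ContDiff ℝ 1 (fun y : Fin 3 → ℝ => y i) := fun i => contDiff_apply ℝ ℝ i
  have hexp : ∀ i : Fin 3, ContDiff ℝ 1 (fun y : Fin 3 → ℝ => Complex.exp ((y i : ℂ) * Complex.I)) := by
    intro i
    exact ((hof.comp (hap i)).mul contDiff_const).cexp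
  rw [contDiff_piLp]
  intro i
  fin_cases i
  · exact (hof.comp (Real.contDiff_cos.comp (hap 0))).mul (hexp 1)
  · exact (hof.comp (Real.contDiff_sin.comp (hap 0))).mul (hexp 2)

lemma Psi_surj : SS ⊆ Psi '' (Metric.closedBall 0 4) := by
  intro w hw
  rw [sphere_iff] at hw
  have h0 : ‖w 0‖ ≤ 1 := by nlinarith [sq_nonneg ‖w 1‖, norm_nonneg (w 0)]
  have hpi := Real.pi_lt_four
  refine ⟨![Real.arccos ‖w 0‖, Complex.arg (w 0), Complex.arg (w 1)], ?_, ?_⟩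
  · rw [mem_closedBall_zero_iff, pi_norm_le_iff_of_nonneg (by norm_num)]
    intro i
    fin_cases i
    · simp only [Fin.zero_eta, Matrix.cons_val_zero, Real.norm_eq_abs]
      rw [abs_of_nonneg (Real.arccos_nonneg _)]
      linarith [Real.arccos_le_pi ‖w 0‖]
    · simp only [Real.norm_eq_abs]
      exact (Complex.abs_arg_le_pi _).trans hpi.le
    · simp only [Real.norm_eq_abs]
      exact (Complex.abs_arg_le_pi _).trans hpi.le
  · have e0 : Real.cos (Real.arccos ‖w 0‖) = ‖w 0‖ :=
      Real.cos_arccos (by linarith [norm_nonneg (w 0)]) h0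
    have e1 : Real.sin (Real.arccos ‖w 0‖) = ‖w 1‖ := by
      rw [Real.sin_arccos, show 1 - ‖w 0‖^2 = ‖w 1‖^2 by linarith, Real.sqrt_sq (norm_nonneg _)]
    ext i
    fin_cases i
    · simp only [Psi, Matrix.cons_val_zero, e0]
      exact Complex.norm_mul_exp_arg_mul_I _
    · simp only [Psi, Matrix.cons_val_zero, e1]
      exact Complex.norm_mul_exp_arg_mul_I _

lemma haus_lt_top : (μH[3] : Measure E) SS < ⊤ := by
  obtain ⟨K, hK⟩ : ∃ K, LipschitzOnWith K Psi (Metric.closedBall 0 4) :=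
    Psi_contDiff.locallyLipschitz.locallyLipschitzOn.exists_lipschitzOnWith_of_compact
      (isCompact_closedBall _ _)
  have h1 := hK.hausdorffMeasure_image_le (d := 3) (by norm_num)
  refine lt_of_le_of_lt (measure_mono Psi_surj) (lt_of_le_of_lt h1 ?_)
  have h2 : (μH[3] : Measure (Fin 3 → ℝ)) = volume := by
    have := @hausdorffMeasure_pi_real (Fin 3) _
    simpa using this
  rw [h2]
  exact ENNReal.mul_lt_top (ENNReal.rpow_lt_top_of_nonneg (by norm_num) ENNReal.coe_ne_top)
    (isCompact_closedBall _ _).measure_lt_top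

instance : IsFiniteMeasure mu := ⟨by
  rw [mu, Measure.restrict_apply_univ]; exact haus_lt_top⟩

lemma SS_meas : MeasurableSet SS := Metric.isClosed_sphere.measurableSet
lemma SS_compact : IsCompact SS := isCompact_sphere _ _

lemma ae_SS : ∀ᵐ w ∂mu, w ∈ SS := ae_restrict_mem SS_meas

lemma integrable_of_cont {F : Type*} [NormedAddCommGroup F] {g : E → F} (hg : ContinuousOn g SS) : Integrable g mu := by
  obtain ⟨C, hC⟩ := SS_compact.exists_bound_of_continuousOn hg
  refine Integrable.of_bound (C := C) (hg.aestronglyMeasurable_of_isCompact SS_compact SS_meas) ?_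
  filter_upwards [ae_SS] with w hw using hC w hw

lemma integral_isom (e : E ≃ᵢ E) (he : ∀ w, e w ∈ SS ↔ w ∈ SS) (g : E → ℝ) :
    ∫ w, g (e w) ∂mu = ∫ w, g w ∂mu := by
  have h : MeasurePreserving e mu mu := by
    have := (e.measurePreserving_hausdorffMeasure 3).restrict_preimage SS_meas
    rwa [show e ⁻¹' SS = SS by ext w; exact he w] at this
  exact h.integral_comp e.toHomeomorph.toMeasurableEquiv.measurableEmbedding g

end FB

namespace FB
open MvPolynomial

/-- an orthogonal complex structure on `E` -/
structure IsQ (q : E →L[ℝ] E) : Prop where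
  sq : ∀ w, q (q w) = - w
  nrm : ∀ w, ‖q w‖ = ‖w‖
  orth : ∀ w, inner ℝ w (q w) = 0

def rot (q : E →L[ℝ] E) (t : ℝ) (w : E) : E := Real.cos t • w + Real.sin t • q w

lemma rot_norm {q : E →L[ℝ] E} (hq : IsQ q) (t : ℝ) (w : E) : ‖rot q t w‖ = ‖w‖ := by
  have : ‖rot q t w‖ ^ 2 = ‖w‖ ^ 2 := by
    rw [rot, norm_add_sq_real, real_inner_smul_left, real_inner_smul_right, hq.orth, norm_smul,
      norm_smul, hq.nrm, mul_pow, mul_pow, Real.norm_eq_abs, Real.norm_eq_abs, sq_abs, sq_abs]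
    nlinarith [Real.sin_sq_add_cos_sq t]
  exact (sq_eq_sq₀ (norm_nonneg _) (norm_nonneg _)).1 this

lemma rot_rot {q : E →L[ℝ] E} (hq : IsQ q) (t : ℝ) (w : E) : rot q t (rot q (-t) w) = w := by
  simp only [rot, map_add, map_smul, hq.sq, Real.cos_neg, Real.sin_neg]
  have h := Real.sin_sq_add_cos_sq t
  have : w = (Real.sin t ^ 2 + Real.cos t ^ 2) • w := by rw [h, one_smul]
  conv_rhs => rw [this]
  module

lemma rot_sub (q : E →L[ℝ] E) (t : ℝ) (v w : E) : rot q t v - rot q t w = rot q t (v - w) := by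
  simp only [rot, map_sub, smul_sub]; abel

def rotE {q : E →L[ℝ] E} (hq : IsQ q) (t : ℝ) : E ≃ᵢ E where
  toFun := rot q t
  invFun := rot q (-t)
  left_inv w := by have := rot_rot hq (-t) w; rwa [neg_neg] at this
  right_inv w := rot_rot hq t w
  isometry_toFun := Isometry.of_dist_eq (fun v w => by
    rw [dist_eq_norm, dist_eq_norm, rot_sub, rot_norm hq])

lemma rot_mem {q : E →L[ℝ] E} (hq : IsQ q) (t : ℝ) (w : E) : rot q t w ∈ SS ↔ w ∈ SS := by
  rw [mem_sphere_zero_iff_norm, mem_sphere_zero_iff_norm, rot_norm hq]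

lemma ne_zero_of_SS {w : E} (hw : w ∈ SS) : w ∈ ({0}ᶜ : Set E) := by
  rintro rfl
  simp at hw

lemma rot_deriv {q : E →L[ℝ] E} (hq : IsQ q) (t : ℝ) (w : E) :
    HasDerivAt (fun t => rot q t w) (q (rot q t w)) t := by
  have h := ((Real.hasDerivAt_cos t).smul_const w).add ((Real.hasDerivAt_sin t).smul_const (q w))
  have e : q (rot q t w) = -Real.sin t • w + Real.cos t • q w := by
    simp only [rot, map_add, map_smul, hq.sq]; module
  rw [e]; exact h

lemma contOn_SS_fderiv {g : E → ℝ} (hg : ContDiffOn ℝ 1 g {0}ᶜ) : ContinuousOn (fderiv ℝ g) SS :=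
  (hg.continuousOn_fderiv_of_isOpen isOpen_compl_singleton le_rfl).mono
    (fun _ hw => ne_zero_of_SS hw)

lemma diffAt_SS {g : E → ℝ} (hg : ContDiffOn ℝ 1 g {0}ᶜ) {w : E} (hw : w ∈ SS) :
    DifferentiableAt ℝ g w :=
  (hg.differentiableOn one_ne_zero).differentiableAt
    (isOpen_compl_singleton.mem_nhds (ne_zero_of_SS hw))

lemma contOn_SS_Q {g : E → ℝ} (hg : ContDiffOn ℝ 1 g {0}ᶜ) (q : E →L[ℝ] E) :
    ContinuousOn (fun w => fderiv ℝ g w (q w)) SS :=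
  (contOn_SS_fderiv hg).clm_apply q.continuous.continuousOn

lemma contOn_SS {g : E → ℝ} (hg : ContDiffOn ℝ 1 g {0}ᶜ) : ContinuousOn g SS :=
  hg.continuousOn.mono (fun _ hw => ne_zero_of_SS hw)

theorem ibp0 {q : E →L[ℝ] E} (hq : IsQ q) {g : E → ℝ} (hg : ContDiffOn ℝ 1 g {0}ᶜ) :
    ∫ w, fderiv ℝ g w (q w) ∂mu = 0 := by
  have hc := contOn_SS_Q hg q
  obtain ⟨C, hC⟩ := SS_compact.exists_bound_of_continuousOn hc
  have hrc : ∀ t, ContinuousOn (rot q t) SS := fun t => (rotE hq t).continuous.continuousOn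
  have hrm : ∀ t, Set.MapsTo (rot q t) SS SS := fun t w hw => (rot_mem hq t w).2 hw
  have key := hasDerivAt_integral_of_dominated_loc_of_deriv_le (μ := mu) (𝕜 := ℝ) (E := ℝ)
    (F := fun t w => g (rot q t w)) (F' := fun t w => fderiv ℝ g (rot q t w) (q (rot q t w)))
    (x₀ := 0) (s := Set.univ) (bound := fun _ => C) Filter.univ_mem
    (Filter.Eventually.of_forall fun t =>
      (integrable_of_cont ((contOn_SS hg).comp (hrc t) (hrm t))).aestronglyMeasurable)
    (integrable_of_cont ((contOn_SS hg).comp (hrc 0) (hrm 0)))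
    (integrable_of_cont (hc.comp (hrc 0) (hrm 0))).aestronglyMeasurable
    (by filter_upwards [ae_SS] with w hw t _ using hC _ (hrm t hw))
    (integrable_const C)
    (by
      filter_upwards [ae_SS] with w hw t _
      exact ((diffAt_SS hg (hrm t hw)).hasFDerivAt).comp_hasDerivAt t (rot_deriv hq t w))
  have hconst : (fun t => ∫ w, g (rot q t w) ∂mu) = fun _ => ∫ w, g w ∂mu := by
    funext t
    exact integral_isom (rotE hq t) (rot_mem hq t) g
  have h2 := key.2
  rw [hconst] at h2
  have h3 := h2.unique (hasDerivAt_const (0:ℝ) _)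
  simpa [rot] using h3

theorem ibp {q : E →L[ℝ] E} (hq : IsQ q) {f g : E → ℝ} (hf : ContDiffOn ℝ 1 f {0}ᶜ)
    (hg : ContDiffOn ℝ 1 g {0}ᶜ) :
    ∫ w, fderiv ℝ f w (q w) * g w ∂mu = - ∫ w, f w * fderiv ℝ g w (q w) ∂mu := by
  have h := ibp0 hq (hf.mul hg)
  have e : ∀ᵐ w ∂mu, fderiv ℝ (fun w => f w * g w) w (q w) =
      fderiv ℝ f w (q w) * g w + f w * fderiv ℝ g w (q w) := by
    filter_upwards [ae_SS] with w hw
    rw [fderiv_fun_mul (diffAt_SS hf hw) (diffAt_SS hg hw)]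
    simp; ring
  rw [integral_congr_ae e, integral_add] at h
  · linarith
  · exact integrable_of_cont ((contOn_SS_Q hf q).mul (contOn_SS hg))
  · exact integrable_of_cont ((contOn_SS hf).mul (contOn_SS_Q hg q))



def q1 : E →L[ℝ] E := LinearMap.toContinuousLinearMap
  { toFun := fun w => Complex.I • w
    map_add' := fun v w => smul_add _ _ _
    map_smul' := fun c w => by ext i; simp; ring }

def q2 : E →L[ℝ] E := LinearMap.toContinuousLinearMap
  { toFun := fun w => WithLp.toLp 2 ![-(starRingEnd ℂ (w 1)), starRingEnd ℂ (w 0)]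
    map_add' := fun v w => by ext i; fin_cases i <;> simp; ring
    map_smul' := fun c w => by ext i; fin_cases i <;> simp }

def q3 : E →L[ℝ] E := LinearMap.toContinuousLinearMap
  { toFun := fun w => WithLp.toLp 2 ![-(Complex.I * starRingEnd ℂ (w 1)), Complex.I * starRingEnd ℂ (w 0)]
    map_add' := fun v w => by ext i; fin_cases i <;> simp <;> ring
    map_smul' := fun c w => by ext i; fin_cases i <;> simp <;> ring }

lemma q1_apply (w : E) : q1 w = Complex.I • w := rfl
lemma q2_apply (w : E) : q2 w = WithLp.toLp 2 ![-(starRingEnd ℂ (w 1)), starRingEnd ℂ (w 0)] := rfl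
lemma q3_apply (w : E) : q3 w = WithLp.toLp 2 ![-(Complex.I * starRingEnd ℂ (w 1)), Complex.I * starRingEnd ℂ (w 0)] := rfl

lemma inner_E (v w : E) : inner ℝ v w = (v 0).re * (w 0).re + (v 0).im * (w 0).im
    + (v 1).re * (w 1).re + (v 1).im * (w 1).im := by
  simp [PiLp.inner_apply]; ring

lemma normsq_E (w : E) : ‖w‖ ^ 2 = (w 0).re ^ 2 + (w 0).im ^ 2 + (w 1).re ^ 2 + (w 1).im ^ 2 := by
  rw [← real_inner_self_eq_norm_sq, inner_E]; ring

lemma IsQ.mk' (q : E →L[ℝ] E) (hsq : ∀ w, q (q w) = - w) (hn : ∀ w, ‖q w‖ ^ 2 = ‖w‖ ^ 2)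
    (ho : ∀ w, inner ℝ w (q w) = 0) : IsQ q :=
  ⟨hsq, fun w => (sq_eq_sq₀ (norm_nonneg _) (norm_nonneg _)).1 (hn w), ho⟩

lemma hq1 : IsQ q1 := by
  apply IsQ.mk'
  · intro w; rw [q1_apply, q1_apply, smul_smul, Complex.I_mul_I, neg_one_smul]
  · intro w; rw [normsq_E, normsq_E, q1_apply]; simp; ring
  · intro w; rw [inner_E, q1_apply]; simp; ring
lemma hq2 : IsQ q2 := by
  apply IsQ.mk'
  · intro w; rw [q2_apply, q2_apply]; ext i; fin_cases i <;> simp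
  · intro w; rw [normsq_E, normsq_E, q2_apply]; simp; ring
  · intro w; rw [inner_E, q2_apply]; simp; ring
lemma hq3 : IsQ q3 := by
  apply IsQ.mk'
  · intro w; rw [q3_apply, q3_apply]; ext i
    fin_cases i <;> simp <;> rw [← mul_assoc, Complex.I_mul_I] <;> ring
  · intro w; rw [normsq_E, normsq_E, q3_apply]; simp; ring
  · intro w; rw [inner_E, q3_apply]; simp; ring

/-- Bessel inequality -/
lemma bessel (g w : E) (hw : w ∈ SS) :
    inner ℝ g (q1 w) ^ 2 + inner ℝ g (q2 w) ^ 2 + inner ℝ g (q3 w) ^ 2 ≤ ‖g‖ ^ 2 := by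
  have h1 : ‖w‖ ^ 2 = 1 := by rw [mem_sphere_zero_iff_norm.1 hw]; norm_num
  have : inner ℝ g w ^ 2 + (inner ℝ g (q1 w) ^ 2 + inner ℝ g (q2 w) ^ 2 + inner ℝ g (q3 w) ^ 2)
      = ‖g‖ ^ 2 * ‖w‖ ^ 2 := by
    rw [normsq_E, normsq_E, inner_E, inner_E, inner_E, inner_E, q1_apply, q2_apply, q3_apply]
    simp; ring
  rw [h1, mul_one] at this
  nlinarith [sq_nonneg (inner ℝ g w)]

/-! polynomials -/
def co (w : E) : Fin 4 → ℝ := ![(w 0).re, (w 0).im, (w 1).re, (w 1).im]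

def pe (p : Pol) (w : E) : ℝ := eval (co w) p

def coL : E →L[ℝ] (Fin 4 → ℝ) := LinearMap.toContinuousLinearMap
  { toFun := co
    map_add' := fun v w => by ext i; fin_cases i <;> simp [co]
    map_smul' := fun c w => by ext i; fin_cases i <;> simp [co] }

lemma coL_apply (w : E) : coL w = co w := rfl

lemma pe_X (i : Fin 4) : pe (X i) = fun w => (ContinuousLinearMap.proj (R := ℝ) i ∘L coL) w := by
  funext w; simp [pe, coL_apply]

lemma pe_C (c : ℝ) : pe (C c) = fun _ => c := by funext w; simp [pe]
lemma pe_add (p q : Pol) : pe (p + q) = fun w => pe p w + pe q w := by funext w; simp [pe]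
lemma pe_mul (p q : Pol) : pe (p * q) = fun w => pe p w * pe q w := by funext w; simp [pe]

lemma pe_contDiff (p : Pol) : ContDiff ℝ 1 (pe p) := by
  induction p using MvPolynomial.induction_on with
  | C a => rw [pe_C]; exact contDiff_const
  | add p q hp hq => rw [pe_add]; exact hp.add hq
  | mul_X p i hp =>
    rw [pe_mul]; refine hp.mul ?_
    rw [pe_X]; exact ContinuousLinearMap.contDiff _

lemma pe_cd (p : Pol) : ContDiffOn ℝ 1 (pe p) {0}ᶜ := (pe_contDiff p).contDiffOn

lemma pe_diff (p : Pol) (w : E) : DifferentiableAt ℝ (pe p) w :=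
  (pe_contDiff p).differentiable one_ne_zero w

lemma pe_fderiv {q : E →L[ℝ] E} {D : Derivation ℝ Pol Pol}
    (h : ∀ i w, pe (D (X i)) w = co (q w) i) (p : Pol) (w : E) :
    fderiv ℝ (pe p) w (q w) = pe (D p) w := by
  induction p using MvPolynomial.induction_on with
  | C a => rw [pe_C, MvPolynomial.derivation_C]; simp [pe]
  | add p q hp hq =>
    rw [pe_add, fderiv_fun_add (pe_diff _ _) (pe_diff _ _), map_add, pe_add]
    simp [hp, hq]
  | mul_X p i hp =>
    rw [pe_mul, fderiv_fun_mul (pe_diff _ _) (pe_diff _ _), Derivation.leibniz, pe_add,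
      smul_eq_mul, smul_eq_mul, pe_mul, pe_mul]
    have : fderiv ℝ (pe (X i)) w (q w) = co (q w) i := by
      rw [pe_X, ContinuousLinearMap.fderiv]; rfl
    simp [hp, this, h]

lemma pe1 (p : Pol) (w : E) : fderiv ℝ (pe p) w (q1 w) = pe (D1 p) w := by
  apply pe_fderiv
  intro i w; rw [D1_X, q1_apply]; fin_cases i <;> simp [pe, co]
lemma pe2 (p : Pol) (w : E) : fderiv ℝ (pe p) w (q2 w) = pe (D2 p) w := by
  apply pe_fderiv
  intro i w; rw [D2_X, q2_apply]; fin_cases i <;> simp [pe, co]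
lemma pe3 (p : Pol) (w : E) : fderiv ℝ (pe p) w (q3 w) = pe (D3 p) w := by
  apply pe_fderiv
  intro i w; rw [D3_X, q3_apply]; fin_cases i <;> simp [pe, co]

/-! the Hilbert space -/
abbrev HH := Lp ℝ 2 mu

lemma memLp_of_cont {g : E → ℝ} (hg : ContinuousOn g SS) : MemLp g 2 mu := by
  obtain ⟨C, hC⟩ := SS_compact.exists_bound_of_continuousOn hg
  refine MemLp.of_bound (hg.aestronglyMeasurable_of_isCompact SS_compact SS_meas) C ?_
  filter_upwards [ae_SS] with w hw using hC w hw

def cl {g : E → ℝ} (hg : ContinuousOn g SS) : HH := (memLp_of_cont hg).toLp g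

lemma inner_cl {f g : E → ℝ} (hf : ContinuousOn f SS) (hg : ContinuousOn g SS) :
    inner ℝ (cl hf) (cl hg) = ∫ w, f w * g w ∂mu := by
  rw [MeasureTheory.L2.inner_def]
  apply integral_congr_ae
  filter_upwards [(memLp_of_cont hf).coeFn_toLp, (memLp_of_cont hg).coeFn_toLp] with w h1 h2
  rw [cl, cl, h1, h2]; simp; ring

lemma normsq_cl {f : E → ℝ} (hf : ContinuousOn f SS) : ‖cl hf‖ ^ 2 = ∫ w, f w ^ 2 ∂mu := by
  rw [← real_inner_self_eq_norm_sq, inner_cl]; simp only [sq]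

lemma pe_cont (p : Pol) : ContinuousOn (pe p) SS := (pe_contDiff p).continuous.continuousOn

def phi : Pol →ₗ[ℝ] HH where
  toFun p := cl (pe_cont p)
  map_add' p q := by
    simp only [cl]
    rw [← MemLp.toLp_add]
    congr 1
    exact pe_add p q
  map_smul' c p := by
    simp only [cl, RingHom.id_apply]
    rw [← MemLp.toLp_const_smul]
    congr 1
    funext w; simp [pe]

lemma phi_apply (p : Pol) : phi p = cl (pe_cont p) := rfl

lemma phi_I : ∀ p ∈ Iid, phi p = 0 := by
  intro p hp
  obtain ⟨a, rfl⟩ := Ideal.mem_span_singleton'.1 hp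
  have : ‖phi (a * (rho - 1))‖ ^ 2 = 0 := by
    rw [phi_apply, normsq_cl]
    rw [integral_eq_zero_of_ae]
    filter_upwards [ae_SS] with w hw
    have h1 : ‖w‖ ^ 2 = 1 := by rw [mem_sphere_zero_iff_norm.1 hw]; norm_num
    rw [normsq_E] at h1
    simp [pe, rho, co, h1]
  simpa using this

lemma anti_gen {q : E →L[ℝ] E} (hq : IsQ q) {D : Derivation ℝ Pol Pol}
    (h : ∀ p w, fderiv ℝ (pe p) w (q w) = pe (D p) w) : Anti phi D := by
  intro p r
  simp only [phi_apply]
  rw [inner_cl, inner_cl]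
  have := ibp hq (pe_cd p) (pe_cd r)
  simpa only [h] using this

lemma anti1 : Anti phi D1 := anti_gen hq1 pe1
lemma anti2 : Anti phi D2 := anti_gen hq2 pe2
lemma anti3 : Anti phi D3 := anti_gen hq3 pe3

lemma weak_gen {q : E →L[ℝ] E} (hq : IsQ q) {D : Derivation ℝ Pol Pol}
    (h : ∀ p w, fderiv ℝ (pe p) w (q w) = pe (D p) w) {u : E → ℝ} (hu : ContDiffOn ℝ 1 u {0}ᶜ)
    (p : Pol) :
    inner ℝ (cl (contOn_SS_Q hu q)) (phi p) = - inner ℝ (cl (contOn_SS hu)) (phi (D p)) := by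
  simp only [phi_apply]
  rw [inner_cl, inner_cl]
  have := ibp hq hu (pe_cd p)
  simpa only [h] using this

end FB

namespace FB
open MvPolynomial

lemma norm_cl_le {f : E → ℝ} (hf : ContinuousOn f SS) {C : ℝ} (_hC : 0 ≤ C)
    (h : ∀ w ∈ SS, |f w| ≤ C) : ‖cl hf‖ ^ 2 ≤ C ^ 2 * mu.real Set.univ := by
  rw [normsq_cl]
  have : ∫ w, f w ^ 2 ∂mu ≤ ∫ _w, C ^ 2 ∂mu := by
    apply integral_mono_ae (integrable_of_cont (hf.pow 2)) (integrable_const _)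
    filter_upwards [ae_SS] with w hw
    have := h w hw
    change f w ^ 2 ≤ C ^ 2
    rw [← sq_abs]; gcongr
  simpa [mul_comm] using this

lemma cl_sub {f g : E → ℝ} (hf : ContinuousOn f SS) (hg : ContinuousOn g SS) :
    cl hf - cl hg = cl (hf.sub hg) := by
  simp only [cl]
  rw [← MemLp.toLp_sub]

def Xc (i : Fin 4) : C(SS, ℝ) := ⟨fun w => co w.1 i, by
  have : Continuous fun w : E => coL w i := (continuous_apply i).comp coL.continuous
  exact this.comp continuous_subtype_val⟩

lemma aeval_Xc (p : Pol) (w : SS) : aeval Xc p w = pe p w.1 := by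
  induction p using MvPolynomial.induction_on with
  | C a => simp [pe]
  | add p q hp hq => rw [map_add, pe_add]; simp [hp, hq]
  | mul_X p i hp => rw [map_mul, pe_mul]; simp [hp, pe]; left; rfl

lemma unif_dense {g : E → ℝ} (hg : ContinuousOn g SS) {ε : ℝ} (hε : 0 < ε) :
    ∃ p : Pol, ∀ w ∈ SS, |g w - pe p w| ≤ ε := by
  have : CompactSpace SS := isCompact_iff_compactSpace.1 SS_compact
  let A : Subalgebra ℝ C(SS, ℝ) := (aeval Xc : Pol →ₐ[ℝ] C(SS, ℝ)).range
  have hsep : A.SeparatesPoints := by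
    intro v w hvw
    by_contra hcon
    push Not at hcon
    apply hvw
    have h : ∀ i, co v.1 i = co w.1 i := by
      intro i
      exact hcon _ ⟨Xc i, ⟨X i, by simp⟩, rfl⟩
    apply Subtype.ext
    have h0 := h 0
    have h1 := h 1
    have h2 := h 2
    have h3 := h 3
    simp [co] at h0 h1 h2 h3
    ext i
    fin_cases i
    · exact Complex.ext h0 h1
    · exact Complex.ext h2 h3
  have htop := ContinuousMap.subalgebra_topologicalClosure_eq_top_of_separatesPoints A hsep
  let G : C(SS, ℝ) := ⟨SS.domRestrict g, hg.domRestrict⟩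
  have hG : G ∈ closure (A : Set C(SS, ℝ)) := by
    have : G ∈ A.topologicalClosure := by rw [htop]; trivial
    exact this
  obtain ⟨b, hb, hd⟩ := Metric.mem_closure_iff.1 hG ε hε
  obtain ⟨p, rfl⟩ := hb
  refine ⟨p, fun w hw => ?_⟩
  have := ContinuousMap.dist_apply_le_dist (f := G) (g := aeval Xc p) ⟨w, hw⟩
  rw [Real.dist_eq] at this
  have e : aeval Xc p (⟨w, hw⟩ : SS) = pe p w := aeval_Xc p ⟨w, hw⟩
  refine le_trans (le_of_eq ?_) (this.trans hd.le)
  rw [← e]; rfl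

lemma dense_phi {g : E → ℝ} (hg : ContinuousOn g SS) : ∀ ε > 0, ∃ p, ‖cl hg - phi p‖ < ε := by
  intro ε hε
  set M := mu.real Set.univ
  have hM : 0 ≤ M := measureReal_nonneg
  obtain ⟨p, hp⟩ := unif_dense hg (ε := ε / (M + 1)) (by positivity)
  refine ⟨p, ?_⟩
  rw [phi_apply, cl_sub]
  have h := norm_cl_le (hg.sub (pe_cont p)) (C := ε / (M+1)) (by positivity) hp
  refine lt_of_pow_lt_pow_left₀ 2 hε.le (lt_of_le_of_lt h ?_)
  change (ε / (M+1)) ^ 2 * M < ε ^ 2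
  rw [div_pow, div_mul_eq_mul_div, div_lt_iff₀ (by positivity)]
  have : 0 < ε ^ 2 := by positivity
  have h2 : M < (M+1)^2 := by nlinarith
  gcongr

end FB

namespace FB
open MvPolynomial

def JJ : Pol →ₗ[ℝ] ℝ where
  toFun p := ∫ w, pe p w ∂mu
  map_add' p q := by
    simp only [pe_add]
    exact integral_add (integrable_of_cont (pe_cont p)) (integrable_of_cont (pe_cont q))
  map_smul' c p := by
    simp only [RingHom.id_apply, smul_eq_mul]
    rw [← integral_const_mul]
    congr 1; funext w; simp [pe]

lemma JJ_apply (p : Pol) : JJ p = ∫ w, pe p w ∂mu := rfl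

lemma JJ1 (p : Pol) : JJ (D1 p) = 0 := by
  rw [JJ_apply, ← ibp0 hq1 (pe_cd p)]; simp only [pe1]
lemma JJ2 (p : Pol) : JJ (D2 p) = 0 := by
  rw [JJ_apply, ← ibp0 hq2 (pe_cd p)]; simp only [pe2]
lemma JJ3 (p : Pol) : JJ (D3 p) = 0 := by
  rw [JJ_apply, ← ibp0 hq3 (pe_cd p)]; simp only [pe3]

lemma JJ_one : JJ 1 = mu.real Set.univ := by
  rw [JJ_apply]; simp [pe]

lemma JJ_X (i : Fin 4) : JJ (X i) = 0 := by
  fin_cases i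
  · have := JJ1 (X 1); simpa [D1_X] using this
  · have := JJ1 (X 0); simpa [D1_X] using this
  · have := JJ1 (X 3); simpa [D1_X] using this
  · have := JJ1 (X 2); simpa [D1_X] using this

lemma JJ_two {p : Pol} (h : JJ (p + p) = 0) : JJ p = 0 := by
  rw [map_add] at h; linarith

lemma JJ01 : JJ (X 0 * X 1) = 0 := by
  have := JJ1 (X 0 * X 0)
  rw [show D1 (X 0 * X 0) = -(X 0 * X 1 + X 0 * X 1) by
    rw [Derivation.leibniz, D1_X]; simp, map_neg, neg_eq_zero] at this
  exact JJ_two this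
lemma JJ23 : JJ (X 2 * X 3) = 0 := by
  have := JJ1 (X 2 * X 2)
  rw [show D1 (X 2 * X 2) = -(X 2 * X 3 + X 2 * X 3) by
    rw [Derivation.leibniz, D1_X]; simp, map_neg, neg_eq_zero] at this
  exact JJ_two this
lemma JJ02 : JJ (X 0 * X 2) = 0 := by
  have := JJ2 (X 0 * X 0)
  rw [show D2 (X 0 * X 0) = -(X 0 * X 2 + X 0 * X 2) by
    rw [Derivation.leibniz, D2_X]; simp, map_neg, neg_eq_zero] at this
  exact JJ_two this
lemma JJ13 : JJ (X 1 * X 3) = 0 := by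
  have := JJ2 (X 1 * X 1)
  rw [show D2 (X 1 * X 1) = (X 1 * X 3 + X 1 * X 3) by
    rw [Derivation.leibniz, D2_X]; simp] at this
  exact JJ_two this
lemma JJ03 : JJ (X 0 * X 3) = 0 := by
  have := JJ3 (X 0 * X 0)
  rw [show D3 (X 0 * X 0) = -(X 0 * X 3 + X 0 * X 3) by
    rw [Derivation.leibniz, D3_X]; simp, map_neg, neg_eq_zero] at this
  exact JJ_two this
lemma JJ12 : JJ (X 1 * X 2) = 0 := by
  have := JJ3 (X 1 * X 1)
  rw [show D3 (X 1 * X 1) = -(X 1 * X 2 + X 1 * X 2) by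
    rw [Derivation.leibniz, D3_X]; simp, map_neg, neg_eq_zero] at this
  exact JJ_two this

lemma JJd1 : JJ (X 1 * X 1) = JJ (X 0 * X 0) := by
  have := JJ1 (X 0 * X 1)
  rw [show D1 (X 0 * X 1) = X 0 * X 0 - X 1 * X 1 by
    rw [Derivation.leibniz, D1_X, D1_X]; simp; ring, map_sub] at this
  linarith
lemma JJd2 : JJ (X 2 * X 2) = JJ (X 0 * X 0) := by
  have := JJ2 (X 0 * X 2)
  rw [show D2 (X 0 * X 2) = X 0 * X 0 - X 2 * X 2 by
    rw [Derivation.leibniz, D2_X, D2_X]; simp; ring, map_sub] at this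
  linarith
lemma JJd3 : JJ (X 3 * X 3) = JJ (X 0 * X 0) := by
  have := JJ3 (X 0 * X 3)
  rw [show D3 (X 0 * X 3) = X 0 * X 0 - X 3 * X 3 by
    rw [Derivation.leibniz, D3_X, D3_X]; simp; ring, map_sub] at this
  linarith

lemma JJ00 : JJ (X 0 * X 0) = mu.real Set.univ / 4 := by
  have h : JJ (X 0 * X 0 + X 1 * X 1 + X 2 * X 2 + X 3 * X 3) = mu.real Set.univ := by
    rw [← JJ_one, JJ_apply, JJ_apply]
    apply integral_congr_ae
    filter_upwards [ae_SS] with w hw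
    have h1 : ‖w‖ ^ 2 = 1 := by rw [mem_sphere_zero_iff_norm.1 hw]; norm_num
    rw [normsq_E] at h1
    simp [pe, co]; linarith
  rw [map_add, map_add, map_add, JJd1, JJd2, JJd3] at h
  linarith

lemma JJ_XX (i j : Fin 4) : JJ (X i * X j) = if i = j then mu.real Set.univ / 4 else 0 := by
  have c10 : JJ (X 1 * X 0) = 0 := by rw [mul_comm]; exact JJ01
  have c20 : JJ (X 2 * X 0) = 0 := by rw [mul_comm]; exact JJ02
  have c30 : JJ (X 3 * X 0) = 0 := by rw [mul_comm]; exact JJ03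
  have c21 : JJ (X 2 * X 1) = 0 := by rw [mul_comm]; exact JJ12
  have c31 : JJ (X 3 * X 1) = 0 := by rw [mul_comm]; exact JJ13
  have c32 : JJ (X 3 * X 2) = 0 := by rw [mul_comm]; exact JJ23
  have d1 := JJd1.trans JJ00
  have d2 := JJd2.trans JJ00
  have d3 := JJd3.trans JJ00
  fin_cases i <;> fin_cases j <;>
    simp [c10, c20, c30, c21, c31, c32, JJ01, JJ02, JJ03, JJ12, JJ13, JJ23, JJ00, d1, d2, d3]

lemma inner_phi (p q : Pol) : inner ℝ (phi p) (phi q) = JJ (p * q) := by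
  rw [phi_apply, phi_apply, inner_cl, JJ_apply, pe_mul]

lemma W1_form (P : Pol) (hP : P ∈ W 1) :
    ∃ (a : ℝ) (b : Fin 4 → ℝ), P = a • (1 : Pol) + ∑ i, b i • (X i : Pol) := by
  have key := W_ind (motive := fun k p => (k = 0 → ∃ a : ℝ, p = a • (1 : Pol)) ∧
    (k = 1 → ∃ (a : ℝ) (b : Fin 4 → ℝ), p = a • (1 : Pol) + ∑ i, b i • (X i : Pol)))
    ?_ ?_ ?_ ?_ 1 P hP
  · exact key.2 rfl
  · rintro k p q ⟨hp0, hp1⟩ ⟨hq0, hq1⟩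
    refine ⟨fun hk => ?_, fun hk => ?_⟩
    · obtain ⟨a, rfl⟩ := hp0 hk
      obtain ⟨b, rfl⟩ := hq0 hk
      exact ⟨a + b, by rw [add_smul]⟩
    · obtain ⟨a, b, rfl⟩ := hp1 hk
      obtain ⟨a', b', rfl⟩ := hq1 hk
      exact ⟨a + a', b + b', by
        simp only [add_smul, Pi.add_apply, Finset.sum_add_distrib]; abel⟩
  · intro c
    exact ⟨fun _ => ⟨c, by rw [MvPolynomial.smul_eq_C_mul, mul_one]⟩, fun h => by omega⟩
  · rintro k p _ ⟨h0, h1⟩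
    refine ⟨fun h => by omega, fun hk => ?_⟩
    obtain ⟨a, rfl⟩ := h0 (by omega)
    exact ⟨a, 0, by simp⟩
  · rintro k p i _ ⟨h0, h1⟩
    refine ⟨fun h => by omega, fun hk => ?_⟩
    obtain ⟨a, rfl⟩ := h0 (by omega)
    refine ⟨0, Pi.single i a, ?_⟩
    rw [Finset.sum_eq_single i]
    · simp
    · intro j _ hj; simp [Pi.single_eq_of_ne hj]
    · simp

/-- the projection on degree ≤ 1 is controlled by the moments -/
lemma proj_est {u : E → ℝ} (hu : ContinuousOn u SS) (P1 : Pol) (hP1 : P1 ∈ W 1)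
    (ho : ∀ Q ∈ W 1, inner ℝ (cl hu - phi P1) (phi Q) = 0) (K : ℝ) (hK : 0 ≤ K)
    (h0 : (∫ w, u w ∂mu) ^ 2 ≤ K * mu.real Set.univ)
    (h1 : ∀ i, (∫ w, u w * co w i ∂mu) ^ 2 ≤ K * mu.real Set.univ) :
    ‖phi P1‖ ^ 2 ≤ 17 * K := by
  obtain ⟨a, b, rfl⟩ := W1_form P1 hP1
  set M := mu.real Set.univ with hM
  have hM0 : 0 ≤ M := measureReal_nonneg
  set P : Pol := a • (1 : Pol) + ∑ i, b i • (X i : Pol) with hP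
  have e1 : JJ (P * 1) = a * M := by
    rw [hP, mul_one, map_add, map_smul, map_sum]
    simp [JJ_X, JJ_one, ← hM]
  have eX : ∀ j, JJ (P * X j) = b j * (M / 4) := by
    intro j
    rw [hP, add_mul, Finset.sum_mul, map_add, map_sum]
    simp only [smul_mul_assoc, one_mul, map_smul, JJ_X, JJ_XX]
    simp [← hM]
  have m0 : ∫ w, u w ∂mu = a * M := by
    have h := ho 1 (by simpa using C_mem_W 1 1)
    rw [inner_sub_left, inner_phi, e1, phi_apply, inner_cl] at h
    have : ∫ w, u w * pe 1 w ∂mu = ∫ w, u w ∂mu := by simp [pe]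
    linarith
  have mX : ∀ j, ∫ w, u w * co w j ∂mu = b j * (M / 4) := by
    intro j
    have h := ho (X j) (X_mem_W1 j)
    rw [inner_sub_left, inner_phi, eX, phi_apply, inner_cl] at h
    have : ∫ w, u w * pe (X j) w ∂mu = ∫ w, u w * co w j ∂mu := by simp [pe]
    linarith
  have hn : ‖phi P‖ ^ 2 = a ^ 2 * M + ∑ j, b j ^ 2 * (M / 4) := by
    rw [← real_inner_self_eq_norm_sq, inner_phi]
    conv_lhs => rw [show P * P = a • (P * 1) + ∑ i, b i • (P * X i) by
      nth_rw 2 [hP]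
      rw [mul_add, Finset.mul_sum]; simp only [mul_smul_comm]]
    rw [map_add, map_smul, map_sum, e1]
    simp only [map_smul, eX, smul_eq_mul]
    congr 1
    · ring
    · apply Finset.sum_congr rfl; intro i _; ring
  rw [hn, Fin.sum_univ_four]
  rw [m0] at h0
  simp only [mX] at h1
  rcases hM0.eq_or_lt with h | h
  · rw [← h]; simp; exact hK
  · have k0 : a ^ 2 * M ≤ K := by
      have : (a^2 * M) * M ≤ K * M := by nlinarith
      exact le_of_mul_le_mul_right this h
    have k1 : ∀ i, b i ^ 2 * (M / 4) ≤ 4 * K := by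
      intro i
      have := h1 i
      have : (b i ^2 * (M / 4)) * M ≤ (4 * K) * M := by nlinarith
      exact le_of_mul_le_mul_right this h
    have := k1 0
    have := k1 1
    have := k1 2
    have := k1 3
    linarith

/-- spectral estimate -/
theorem spectral {u : E → ℝ} (hu : ContDiffOn ℝ 1 u {0}ᶜ) (K : ℝ) (hK : 0 ≤ K)
    (h0 : (∫ w, u w ∂mu) ^ 2 ≤ K * mu.real Set.univ)
    (h1 : ∀ i, (∫ w, u w * co w i ∂mu) ^ 2 ≤ K * mu.real Set.univ) :
    8 * (∫ w, u w ^ 2 ∂mu - 17 * K) ≤ ∫ w, ‖gradient u w‖ ^ 2 ∂mu ∧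
    2 * (∫ w, u w ^ 2 ∂mu - 17 * K) ≤
      ∫ w, (‖gradient u w‖ ^ 2 - inner ℝ (gradient u w) (Complex.I • w) ^ 2) ∂mu := by
  obtain ⟨P1, hP1, ho⟩ := exists_proj phi 1 (cl (contOn_SS hu))
  have hp := proj_est (contOn_SS hu) P1 hP1 ho K hK h0 h1
  have g := gap_abstract phi_I anti1 anti2 anti3 (cl (contOn_SS hu)) (cl (contOn_SS_Q hu q1))
    (cl (contOn_SS_Q hu q2)) (cl (contOn_SS_Q hu q3)) (weak_gen hq1 pe1 hu) (weak_gen hq2 pe2 hu)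
    (weak_gen hq3 pe3 hu) (dense_phi _) P1 hP1 ho
  have cq : ∀ q : E →L[ℝ] E, Integrable (fun w => (fderiv ℝ u w (q w)) ^ 2) mu :=
    fun q => integrable_of_cont ((contOn_SS_Q hu q).pow 2)
  simp only [normsq_cl] at g
  have hgc : ContinuousOn (gradient u) SS := by
    unfold gradient
    exact (InnerProductSpace.toDual ℝ E).symm.continuous.comp_continuousOn (contOn_SS_fderiv hu)
  have hin : ∀ w v, inner ℝ (gradient u w) v = fderiv ℝ u w v := by
    intro w v; simp [gradient]
  have cx : ContinuousOn (fun w => ‖gradient u w‖ ^ 2) SS := hgc.norm.pow 2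
  have cs : ContinuousOn (fun w => inner ℝ (gradient u w) (Complex.I • w) ^ 2) SS := by
    refine ContinuousOn.pow (ContinuousOn.inner hgc ?_) 2
    exact q1.continuous.continuousOn
  constructor
  · have : ∫ w, (fderiv ℝ u w (q1 w) ^ 2 + fderiv ℝ u w (q2 w) ^ 2 + fderiv ℝ u w (q3 w) ^ 2) ∂mu
        ≤ ∫ w, ‖gradient u w‖ ^ 2 ∂mu := by
      apply integral_mono_ae (((cq q1).add (cq q2)).add (cq q3)) (integrable_of_cont cx)
      filter_upwards [ae_SS] with w hw
      have := bessel (gradient u w) w hw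
      simp only [hin] at this
      exact this
    rw [integral_add (by exact (cq q1).add (cq q2)) (cq q3), integral_add (cq q1) (cq q2)] at this
    linarith [g.1]
  · have : ∫ w, (fderiv ℝ u w (q2 w) ^ 2 + fderiv ℝ u w (q3 w) ^ 2) ∂mu
        ≤ ∫ w, (‖gradient u w‖ ^ 2 - inner ℝ (gradient u w) (Complex.I • w) ^ 2) ∂mu := by
      apply integral_mono_ae ((cq q2).add (cq q3)) (integrable_of_cont (cx.sub cs))
      filter_upwards [ae_SS] with w hw
      have := bessel (gradient u w) w hw
      simp only [hin] at this
      change (fderiv ℝ u w) (q2 w) ^ 2 + (fderiv ℝ u w) (q3 w) ^ 2 ≤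
        ‖gradient u w‖ ^ 2 - inner ℝ (gradient u w) (q1 w) ^ 2
      rw [hin]
      linarith
    rw [integral_add (cq q2) (cq q3)] at this
    linarith [g.2]

end FB

namespace FB

/-- second order Taylor (convexity) -/
lemma taylor2 {F F' F'' : ℝ → ℝ} {ε : ℝ} (hF : ∀ v, HasDerivAt F (F' v) v)
    (hF' : ∀ v, HasDerivAt F' (F'' v) v) (h : ∀ v, |v| ≤ ε → 0 ≤ F'' v) (h0 : F' 0 = 0)
    {v : ℝ} (hv : |v| ≤ ε) : F 0 ≤ F v := by
  have hε : 0 ≤ ε := (abs_nonneg v).trans hv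
  have hv' := abs_le.1 hv
  have mono : MonotoneOn F' (Set.Icc (-ε) ε) := by
    apply monotoneOn_of_deriv_nonneg (convex_Icc _ _)
    · exact fun x _ => (hF' x).continuousAt.continuousWithinAt
    · exact fun x _ => (hF' x).differentiableAt.differentiableWithinAt
    · intro x hx
      rw [interior_Icc] at hx
      rw [(hF' x).deriv]
      exact h x (abs_le.2 ⟨hx.1.le, hx.2.le⟩)
  rcases le_total 0 v with hv0 | hv0
  · have : MonotoneOn F (Set.Icc 0 ε) := by
      apply monotoneOn_of_deriv_nonneg (convex_Icc _ _)
      · exact fun x _ => (hF x).continuousAt.continuousWithinAt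
      · exact fun x _ => (hF x).differentiableAt.differentiableWithinAt
      · intro x hx
        rw [interior_Icc] at hx
        rw [(hF x).deriv, ← h0]
        exact mono ⟨by linarith, hε⟩ ⟨by linarith [hx.1], hx.2.le⟩ hx.1.le
    exact this ⟨le_rfl, hε⟩ ⟨hv0, hv'.2⟩ hv0
  · have : AntitoneOn F (Set.Icc (-ε) 0) := by
      apply antitoneOn_of_deriv_nonpos (convex_Icc _ _)
      · exact fun x _ => (hF x).continuousAt.continuousWithinAt
      · exact fun x _ => (hF x).differentiableAt.differentiableWithinAt
      · intro x hx
        rw [interior_Icc] at hx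
        rw [(hF x).deriv, ← h0]
        exact mono ⟨hx.1.le, by linarith [hx.2]⟩ ⟨by linarith, hε⟩ hx.2.le
    exact this ⟨hv'.1, hv0⟩ ⟨by linarith, le_rfl⟩ hv0

/-- first order mean value estimate -/
lemma taylor1 {F F' : ℝ → ℝ} {ε c δ : ℝ} (hF : ∀ v, HasDerivAt F (F' v) v)
    (h : ∀ v, |v| ≤ ε → |F' v - c| ≤ δ) {v : ℝ} (hv : |v| ≤ ε) :
    |F v - F 0 - c * v| ≤ δ * |v| := by
  have hε : 0 ≤ ε := (abs_nonneg v).trans hv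
  have := (convex_Icc (-ε) ε).norm_image_sub_le_of_norm_hasDerivWithin_le
    (f := fun v => F v - c * v) (f' := fun v => F' v - c) (C := δ) (x := 0) (y := v)
    (fun x _ => by
      have := (hF x).sub ((hasDerivAt_id x).const_mul c)
      simp only [mul_one] at this
      exact this.hasDerivWithinAt)
    (fun x hx => h x (abs_le.2 hx)) ⟨by linarith, hε⟩ (abs_le.1 hv)
  simp only [Real.norm_eq_abs, mul_zero, sub_zero] at this
  rwa [show F v - F 0 - c * v = F v - c * v - F 0 by ring]

lemma pq_bounds {p q η : ℝ} (h0 : 0 < η) (h1 : η ≤ 1/1000) (hp : |p - 1| ≤ η) (hq : |q - 1| ≤ η) :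
    |p^3*q - 1| ≤ 5 * η ∧ |p^4 - 1| ≤ 5 * η ∧ p * q ≥ 1 - 5 * η ∧ p^2 ≤ 1 + 5 * η ∧
      p / q ≥ 1 - 8 * η ∧ p^5/q^3 ≥ 1 - 8 * η := by
  have hp' := abs_le.1 hp
  have hq' := abs_le.1 hq
  have lp : 1 - η ≤ p := by linarith
  have up : p ≤ 1 + η := by linarith
  have lq : 1 - η ≤ q := by linarith
  have uq : q ≤ 1 + η := by linarith
  have z : 0 < 1 - η := by linarith
  have p0 : 0 < p := by linarith
  have q0 : 0 < q := by linarith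
  have B : (1 + η)^4 ≤ 1 + 5 * η := by
    have e2 : η^2 ≤ η/1000 := by nlinarith
    have e3 : η^3 ≤ η/1000 := by nlinarith
    have e4 : η^4 ≤ η/1000 := by nlinarith [pow_pos h0 3]
    nlinarith
  have Bl : 1 - 4 * η ≤ (1 - η)^4 := by
    have := one_add_mul_le_pow (a := -η) (by linarith) 4
    push_cast at this
    have e : (1 + -η) = 1 - η := by ring
    rw [e] at this; linarith
  have Bl8 : 1 - 8 * η ≤ (1 - η)^8 := by
    have := one_add_mul_le_pow (a := -η) (by linarith) 8
    push_cast at this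
    have e : (1 + -η) = 1 - η := by ring
    rw [e] at this; linarith
  have qi : 1 - η ≤ 1 / q := by
    rw [le_div_iff₀ q0]; nlinarith
  refine ⟨?_, ?_, ?_, ?_, ?_, ?_⟩
  · rw [abs_le]
    have a1 : p^3*q ≤ (1+η)^3*(1+η) := by gcongr
    have a2 : (1-η)^3*(1-η) ≤ p^3*q := by gcongr
    constructor <;> nlinarith
  · rw [abs_le]
    have a1 : p^4 ≤ (1+η)^4 := by gcongr
    have a2 : (1-η)^4 ≤ p^4 := by gcongr
    constructor <;> nlinarith
  · have a2 : (1-η)*(1-η) ≤ p*q := by gcongr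
    nlinarith
  · have a1 : p^2 ≤ (1+η)^2 := by gcongr
    nlinarith
  · have a2 : (1-η)*(1-η) ≤ p*(1/q) := by gcongr
    rw [mul_one_div] at a2
    nlinarith
  · have a2 : (1-η)^5*(1-η)^3 ≤ p^5*(1/q)^3 := by gcongr
    rw [one_div, inv_pow, ← div_eq_mul_inv] at a2
    have : (1-η)^8 = (1-η)^5*(1-η)^3 := by ring
    linarith

/-- ratio bounds -/
lemma ratio_bounds {a a0 v : ℝ} (ha : 0 < a) (ha0 : a ≤ a0) (hv : |v| ≤ 1/2) :
    |sinh (a * (1 + v)) / sinh a - 1| ≤ (1 + a0) * cosh (2 * a0) * |v| ∧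
    |cosh (a * (1 + v)) / cosh a - 1| ≤ (1 + a0) * cosh (2 * a0) * |v| := by
  have hS : 0 < sinh a := sinh_pos_iff.2 ha
  have hC : 1 ≤ cosh a := one_le_cosh a
  have haS : a ≤ sinh a := self_le_sinh_iff.2 ha.le
  have hcb : ∀ x, |x| ≤ 1/2 → cosh (a * (1 + x)) ≤ cosh (2 * a0) := by
    intro x hx
    have hx' := abs_le.1 hx
    rw [cosh_le_cosh, abs_of_nonneg (by nlinarith), abs_of_nonneg (by linarith)]
    nlinarith
  have hA : ∀ x : ℝ, HasDerivAt (fun x => a * (1 + x)) a x := fun x => by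
    simpa using ((hasDerivAt_id x).const_add 1).const_mul a
  have h1 : ∀ x, |x| ≤ 1/2 → |cosh (a * (1 + x)) * a - 0| ≤ cosh (2 * a0) * a := by
    intro x hx
    rw [sub_zero, abs_of_nonneg (mul_nonneg (cosh_pos _).le ha.le)]
    have := hcb x hx
    gcongr
  have h2 : ∀ x, |x| ≤ 1/2 → |sinh (a * (1 + x)) * a - 0| ≤ cosh (2 * a0) * a := by
    intro x hx
    rw [sub_zero, abs_mul, abs_of_nonneg ha.le]
    have := hcb x hx
    have h3 : |sinh (a * (1+x))| ≤ cosh (a * (1+x)) := by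
      rw [abs_sinh, ← cosh_abs]; exact (sinh_lt_cosh _).le
    gcongr
    linarith
  have k1 := taylor1 (F := fun x => sinh (a * (1 + x))) (fun x => (hA x).sinh) h1 hv
  have k2 := taylor1 (F := fun x => cosh (a * (1 + x))) (fun x => (hA x).cosh) h2 hv
  simp only [add_zero, mul_one, zero_mul, sub_zero] at k1 k2
  have hc0 : 0 < cosh (2 * a0) := cosh_pos _
  have hcv : 0 ≤ cosh (2 * a0) * |v| := by positivity
  constructor
  · rw [div_sub_one hS.ne', abs_div, abs_of_pos hS, div_le_iff₀ hS]
    have : cosh (2 * a0) * |v| * a ≤ cosh (2 * a0) * |v| * sinh a := by gcongr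
    have : 0 ≤ a0 * (cosh (2 * a0) * |v|) * sinh a := by
      have : 0 ≤ a0 := by linarith
      positivity
    nlinarith
  · rw [div_sub_one (by linarith), abs_div, abs_of_pos (by linarith : 0 < cosh a), div_le_iff₀ (by linarith)]
    have h4 : cosh (2 * a0) * |v| * a ≤ cosh (2 * a0) * |v| * ((1 + a0) * cosh a) := by
      gcongr
      nlinarith
    nlinarith

end FB

namespace FB

/-- standing smallness assumptions -/
structure Good (a η ε : ℝ) : Prop where
  ha : 0 < a
  h0 : 0 < η
  h1 : η ≤ 1/1000
  h2 : 190 * η * cosh a ^ 4 ≤ 1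
  e1 : ε ≤ 1/2
  e2 : (1 + 2 * a^2) * ε^2 ≤ 8 * η
  hp : ∀ v, |v| ≤ ε → |sinh (a * (1 + v)) / sinh a - 1| ≤ η
  hq : ∀ v, |v| ≤ ε → |cosh (a * (1 + v)) / cosh a - 1| ≤ η

lemma hasDerivAt_A (a x : ℝ) : HasDerivAt (fun x => a * (1 + x)) a x := by
  simpa using ((hasDerivAt_id x).const_add 1).const_mul a

lemma Good.pq {a η ε : ℝ} (h : Good a η ε) {v : ℝ} (hv : |v| ≤ ε) :
    ∃ p q : ℝ, |p - 1| ≤ η ∧ |q - 1| ≤ η ∧ sinh (a * (1 + v)) = p * sinh a ∧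
      cosh (a * (1 + v)) = q * cosh a := by
  have hS : 0 < sinh a := sinh_pos_iff.2 h.ha
  have hC : 0 < cosh a := cosh_pos a
  exact ⟨_, _, h.hp v hv, h.hq v hv, by field_simp, by field_simp⟩

lemma vol_est {a η ε : ℝ} (h : Good a η ε) {v : ℝ} (hv : |v| ≤ ε) :
    |sinh (a * (1 + v)) ^ 4 - sinh a ^ 4 - (4 * a * sinh a ^ 3 * cosh a) * v| ≤
      (4 * a * sinh a ^ 3 * cosh a) * (5 * η) * |v| := by
  have hS : 0 < sinh a := sinh_pos_iff.2 h.ha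
  have hC : 0 < cosh a := cosh_pos a
  have ha := h.ha
  have := taylor1 (F := fun x => sinh (a * (1 + x)) ^ 4) (ε := ε) (c := 4 * a * sinh a ^ 3 * cosh a)
    (δ := (4 * a * sinh a ^ 3 * cosh a) * (5 * η)) (fun x => (hasDerivAt_A a x).sinh.pow 4) (by
    intro x hx
    obtain ⟨p, q, hp, hq, e1, e2⟩ := h.pq hx
    have := (pq_bounds h.h0 h.h1 hp hq).1
    rw [e1, e2]
    have : ((4:ℕ):ℝ) * (p * sinh a) ^ (4 - 1) * (q * cosh a * a) - 4 * a * sinh a ^ 3 * cosh a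
      = (4 * a * sinh a ^ 3 * cosh a) * (p ^ 3 * q - 1) := by push_cast; ring
    rw [this, abs_mul, abs_of_pos (by positivity)]
    gcongr) hv
  simpa using this

def Hb (r v : ℝ) : ℝ := (1 + v) * ∫ ρ in (0:ℝ)..r, sinh (ρ * (1 + v) / 2) ^ 4

lemma Hb_eq (r v : ℝ) : Hb r v = ∫ σ in (0:ℝ)..(r * (1 + v)), sinh (σ / 2) ^ 4 := by
  have := intervalIntegral.mul_integral_comp_mul_right (a := 0) (b := r)
    (f := fun σ => sinh (σ / 2) ^ 4) (1 + v)
  rw [zero_mul] at this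
  exact this

lemma Hb_est {a η ε : ℝ} (h : Good a η ε) {v : ℝ} (hv : |v| ≤ ε) :
    |Hb (2 * a) v - Hb (2 * a) 0 - (2 * a * sinh a ^ 4) * v| ≤
      (2 * a * sinh a ^ 4) * (5 * η) * |v| := by
  have hS : 0 < sinh a := sinh_pos_iff.2 h.ha
  have ha := h.ha
  have hc : Continuous fun σ : ℝ => sinh (σ / 2) ^ 4 := by fun_prop
  have hd : ∀ x, HasDerivAt (fun x => Hb (2*a) x) (sinh (2*a*(1+x)/2)^4 * (2 * a)) x := by
    intro x
    have h1 := (hc.integral_hasStrictDerivAt 0 (2*a*(1+x))).hasDerivAt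
    have h2 := h1.comp x (hasDerivAt_A (2*a) x)
    refine h2.congr_of_eventuallyEq (Filter.Eventually.of_forall fun y => ?_)
    exact Hb_eq _ _
  refine taylor1 (F := fun x => Hb (2*a) x) (ε := ε) hd (fun x hx => ?_) hv
  obtain ⟨p, q, hp, hq, e1, e2⟩ := h.pq hx
  have := (pq_bounds h.h0 h.h1 hp hq).2.1
  rw [show 2 * a * (1 + x) / 2 = a * (1 + x) by ring, e1]
  have : (p * sinh a) ^ 4 * (2 * a) - 2 * a * sinh a ^ 4 = (2 * a * sinh a ^ 4) * (p ^ 4 - 1) := by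
    ring
  rw [this, abs_mul, abs_of_pos (by positivity)]
  gcongr

/-- the zeroth order part -/
lemma zero_est {a η ε : ℝ} (h : Good a η ε) {v : ℝ} (hv : |v| ≤ ε) :
    sinh a ^ 3 * cosh a + (4 * sinh a ^ 2 + 3) / (4 * sinh a * cosh a) *
        (sinh (a * (1 + v)) ^ 4 - sinh a ^ 4)
      - a ^ 2 * sinh a / cosh a * (2 + sinh a ^ 2) * v ^ 2 ≤
      sinh (a * (1 + v)) ^ 3 * cosh (a * (1 + v)) := by
  have hS : 0 < sinh a := sinh_pos_iff.2 h.ha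
  have hC : 0 < cosh a := cosh_pos a
  have ha := h.ha
  set m := (4 * sinh a ^ 2 + 3) / (4 * sinh a * cosh a) with hm
  set B := a ^ 2 * sinh a / cosh a * (2 + sinh a ^ 2) with hB
  have hsq : ∀ x, cosh x ^ 2 = sinh x ^ 2 + 1 := cosh_sq
  have d1 : ∀ x, HasDerivAt (fun x => sinh (a*(1+x))^3 * cosh (a*(1+x)) - m * sinh (a*(1+x))^4
      + B * x^2) (a * (4 * sinh (a*(1+x))^4 + 3 * sinh (a*(1+x))^2)
        - m * (4 * a * (sinh (a*(1+x))^3 * cosh (a*(1+x)))) + 2 * B * x) x := by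
    intro x
    have hs := (hasDerivAt_A a x).sinh
    have hc := (hasDerivAt_A a x).cosh
    have hh := (((hs.pow 3).mul hc).sub ((hs.pow 4).const_mul m)).add
      (((hasDerivAt_id' x).pow 2).const_mul B)
    refine HasDerivAt.congr_deriv hh ?_
    simp only [Pi.pow_apply]
    push_cast
    have := hsq (a * (1+x))
    linear_combination (3 * a * sinh (a*(1+x))^2) * this
  have d2 : ∀ x, HasDerivAt (fun x => a * (4 * sinh (a*(1+x))^4 + 3 * sinh (a*(1+x))^2)
        - m * (4 * a * (sinh (a*(1+x))^3 * cosh (a*(1+x)))) + 2 * B * x)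
      (a^2 * (16 * sinh (a*(1+x))^3 * cosh (a*(1+x)) + 6 * sinh (a*(1+x)) * cosh (a*(1+x)))
        - m * (4 * a^2 * (4 * sinh (a*(1+x))^4 + 3 * sinh (a*(1+x))^2)) + 2 * B) x := by
    intro x
    have hs := (hasDerivAt_A a x).sinh
    have hc := (hasDerivAt_A a x).cosh
    have hh := (((((hs.pow 4).const_mul 4).add ((hs.pow 2).const_mul 3)).const_mul a).sub
      ((((hs.pow 3).mul hc).const_mul (4 * a)).const_mul m)).add
      ((hasDerivAt_id' x).const_mul (2 * B))
    refine HasDerivAt.congr_deriv hh ?_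
    simp only [Pi.pow_apply]
    push_cast
    have := hsq (a * (1+x))
    linear_combination (-12 * m * a^2 * sinh (a*(1+x))^2) * this
  have key := taylor2 (ε := ε) d1 d2 (fun x hx => ?_) ?_ hv
  · simp only [add_zero, mul_one] at key
    nlinarith
  · obtain ⟨p, q, hp, hq, e1, e2⟩ := h.pq hx
    obtain ⟨b1, b2, b3, b4, -, -⟩ := pq_bounds h.h0 h.h1 hp hq
    rw [e1, e2, hm, hB]
    have b1' := (abs_le.1 b1).1
    have b2' := (abs_le.1 b2).2
    set S := sinh a
    set c := cosh a
    have hc2 : c ^ 2 = S ^ 2 + 1 := hsq a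
    have main : 0 ≤ 16 * S^2 * c^2 * (p^3*q) + 6 * c^2 * (p*q) - (4*S^2+3) * (4*S^2*p^4+3*p^2)
        + (4 + 2*S^2) := by
      have t1 : 16 * S^2 * c^2 * (1 - 5*η) ≤ 16 * S^2 * c^2 * (p^3*q) := by
        gcongr; linarith
      have t2 : 6 * c^2 * (1 - 5*η) ≤ 6 * c^2 * (p*q) := by
        gcongr
      have t3 : (4*S^2+3) * (4*S^2*p^4+3*p^2) ≤ (4*S^2+3) * (4*S^2*(1+5*η)+3*(1+5*η)) := by
        gcongr
        linarith
      have t4 := h.h2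
      have hη := h.h0
      have c4 : c^4 = (S^2+1)^2 := by rw [← hc2]; ring
      change 190 * η * c^4 ≤ 1 at t4
      rw [c4] at t4
      rw [hc2] at t1 t2 ⊢
      have hη2 : 0 ≤ η * S^2 := by positivity
      have hη4 : 0 ≤ η * S^4 := by positivity
      nlinarith
    have e : a^2 * (16 * (p*S)^3 * (q*c) + 6 * (p*S) * (q*c))
        - (4*S^2+3)/(4*S*c) * (4*a^2*(4*(p*S)^4 + 3*(p*S)^2)) + 2 * (a^2*S/c*(2+S^2))
        = a^2 * S / c * (16 * S^2 * c^2 * (p^3*q) + 6 * c^2 * (p*q)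
          - (4*S^2+3) * (4*S^2*p^4+3*p^2) + (4 + 2*S^2)) := by
      field_simp
      ring
    rw [e]
    positivity
  · simp only [add_zero, mul_one, mul_zero]
    rw [hm]
    field_simp
    ring

/-- the integrand -/
def Fi (r v x s : ℝ) : ℝ :=
  Real.tanh (r * (1 + v) / 2) ^ 3
              * (1 - Real.tanh (r * (1 + v) / 2) ^ 2) ^ (-(5:ℝ)/2)
              * Real.sqrt (1 - Real.tanh (r * (1 + v) / 2) ^ 2
                  * ((4 / (r ^ 2 * (1 - Real.tanh (r * (1 + v) / 2) ^ 2) ^ 2)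
                        + s)
                     / (4 / (r ^ 2 * (1 - Real.tanh (r * (1 + v) / 2) ^ 2) ^ 2)
                        + x)))
              * Real.sqrt (1 + r ^ 2 * (1 - Real.tanh (r * (1 + v) / 2) ^ 2) ^ 2
                  * x / (4 * Real.tanh (r * (1 + v) / 2) ^ 2))

lemma one_sub_tanh (A : ℝ) : 1 - tanh A ^ 2 = 1 / cosh A ^ 2 := by
  have := cosh_pos A
  rw [tanh_eq_sinh_div_cosh]
  field_simp
  linarith [cosh_sq A]

lemma rpow_aux {c : ℝ} (hc : 0 < c) : (1 / c ^ 2) ^ (-(5:ℝ)/2) = c ^ 5 := by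
  rw [one_div, Real.inv_rpow (by positivity), neg_div, Real.rpow_neg (by positivity), inv_inv,
    ← Real.rpow_natCast c 2, ← Real.rpow_mul hc.le]
  norm_num

/-- algebraic lower bound of the integrand -/
lemma Fi_alg {a v x s A S c η1 : ℝ} (ha : 0 < a) (hA : A = a * (1 + v)) (hS : S = sinh A)
    (hc : c = cosh A) (hA0 : 0 < A) (hs : 0 ≤ s) (hsx : s ≤ x)
    (hη : x * a^2 / c^4 + (a^2 / (S^2 * c^2) * x + a^2 * S^2 / c^4 * (x - s)) / 4 ≤ η1) (hη1 : η1 ≤ 1) :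
    S ^ 3 * c * (1 + (1 - η1) / 2 * (a^2 / (S^2 * c^2) * x + a^2 * S^2 / c^4 * (x - s)))
      ≤ Fi (2 * a) v x s := by
  have hS0 : 0 < S := by rw [hS]; exact sinh_pos_iff.2 hA0
  have hc0 : 0 < c := by rw [hc]; exact cosh_pos A
  have hcs : c ^ 2 = S ^ 2 + 1 := by rw [hc, hS]; exact cosh_sq A
  have hx : 0 ≤ x := hs.trans hsx
  unfold Fi
  rw [show 2 * a * (1 + v) / 2 = A by rw [hA]; ring, one_sub_tanh, tanh_eq_sinh_div_cosh, ← hS, ← hc,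
    rpow_aux hc0]
  set Z := a^2 / (S^2 * c^2) * x + a^2 * S^2 / c^4 * (x - s) with hZ
  set y := x * a^2 / c^4 with hy
  have hy0 : 0 ≤ y := by positivity
  have hxs : 0 ≤ x - s := by linarith
  have hZ0 : 0 ≤ Z := by positivity
  have e1 : (S / c)^3 * c^5 = S^3 * c * c := by field_simp
  have e2 : 1 - (S/c)^2 * ((4 / ((2*a)^2 * (1 / c^2)^2) + s) / (4 / ((2*a)^2 * (1/c^2)^2) + x))
      = ((1 + y) + a^2 * S^2 / c^4 * (x - s)) / (1 + y) / c^2 := by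
    have : 0 < c^4 + a^2 * x := by positivity
    rw [hy]
    field_simp
    rw [hcs]; ring
  have e3 : 1 + (2*a)^2 * (1/c^2)^2 * x / (4 * (S/c)^2) = 1 + a^2 / (S^2 * c^2) * x := by
    field_simp
    ring
  rw [e1, e2, e3, Real.sqrt_div' _ (by positivity), Real.sqrt_sq hc0.le, mul_assoc, mul_assoc, mul_assoc]
  rw [show c * (√((1 + y + a ^ 2 * S ^ 2 / c ^ 4 * (x - s)) / (1 + y)) / c * √(1 + a ^ 2 / (S ^ 2 * c ^ 2) * x))
    = √((1 + y + a ^ 2 * S ^ 2 / c ^ 4 * (x - s)) / (1 + y)) * √(1 + a ^ 2 / (S ^ 2 * c ^ 2) * x) by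
      field_simp]
  rw [← Real.sqrt_mul (by positivity), ← mul_assoc]
  gcongr
  apply Real.le_sqrt_of_sq_le
  set Z1 := a ^ 2 / (S ^ 2 * c ^ 2) * x
  set Z2 := a ^ 2 * S ^ 2 / c ^ 4 * (x - s)
  have hZ1 : 0 ≤ Z1 := by positivity
  have hZ2 : 0 ≤ Z2 := by positivity
  have h3 : 1 + Z * (1 - y) ≤ (1 + y + Z2) / (1 + y) * (1 + Z1) := by
    rw [div_mul_eq_mul_div, le_div_iff₀ (by positivity), hZ]
    have : 0 ≤ Z1 * Z2 := by positivity
    have : 0 ≤ Z1 * y := by positivity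
    have : 0 ≤ Z1 * y^2 := by positivity
    have : 0 ≤ Z2 * y^2 := by positivity
    nlinarith
  refine le_trans ?_ h3
  have h4 : (1 - η1) * (1 + Z/4*(1-η1)) ≤ 1 - y := by
    have hη0 : 0 ≤ η1 := le_trans (by positivity) hη
    have : (1 - η1)*(1-η1) ≤ 1 := by nlinarith
    have : Z / 4 * ((1 - η1)*(1-η1)) ≤ Z / 4 * 1 := by gcongr
    nlinarith
  have := mul_le_mul_of_nonneg_left h4 hZ0
  nlinarith

lemma low_aux {a η p q S c x s : ℝ} (hη : 0 < η) (hη1 : η ≤ 1/1000) (hS : 0 < S) (hC : 0 < c)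
    (p0 : 0 < p) (q0 : 0 < q) (hx0 : 0 ≤ x) (hxs : 0 ≤ x - s)
    (b5 : p / q ≥ 1 - 8 * η) (b6 : p^5/q^3 ≥ 1 - 8 * η) :
    a ^ 2 * S / c * ((1 - 16 * η) / 2 * (x + S ^ 4 / c ^ 2 * (x - s))) ≤
    (p * S)^3 * (q * c) * ((1 - 8*η)/2 * (a^2 / ((p*S)^2 * (q*c)^2) * x
        + a^2 * (p*S)^2 / (q*c)^4 * (x - s))) := by
  have e : (p * S)^3 * (q * c) * ((1 - 8*η)/2 * (a^2 / ((p*S)^2 * (q*c)^2) * x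
      + a^2 * (p*S)^2 / (q*c)^4 * (x - s)))
      = a^2 * S / c * ((1 - 8*η)/2 * (p/q * x + p^5/q^3 * (S^4/c^2 * (x-s)))) := by
    field_simp
  rw [e]
  have f1 : (1 - 8*η) * x ≤ p/q * x := by gcongr
  have f2 : (1 - 8*η) * (S^4/c^2 * (x-s)) ≤ p^5/q^3 * (S^4/c^2 * (x-s)) := by gcongr
  have f0 : 0 ≤ x + S^4/c^2*(x-s) := by positivity
  have fk : 0 ≤ a^2 * S / c := by positivity
  refine mul_le_mul_of_nonneg_left ?_ fk
  have f3 : (1-8*η)/2 * ((1 - 8*η) * x + (1 - 8*η) * (S^4/c^2 * (x-s))) ≤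
    (1-8*η)/2 * (p/q * x + p^5/q^3 * (S^4/c^2 * (x-s))) := by
    apply mul_le_mul_of_nonneg_left (by linarith); linarith
  nlinarith [mul_nonneg (sq_nonneg η) f0]

lemma small_aux {a η ε v SA CA x s : ℝ} (ha : 0 < a) (hv2 : -(1/2) ≤ v) (hSA : a * (1 + v) ≤ SA)
    (hCA : 1 ≤ CA) (hcsA : CA^2 = SA^2 + 1) (hSA0 : 0 < SA) (hx0 : 0 ≤ x) (hs : 0 ≤ s) (hxs : 0 ≤ x - s)
    (hx : x ≤ ε^2) (he2 : (1 + 2 * a^2) * ε^2 ≤ 8 * η) :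
    x * a^2 / CA^4 + (a^2 / (SA^2 * CA^2) * x + a^2 * SA^2 / CA^4 * (x - s)) / 4 ≤ 8 * η := by
  have hc1 : 1 ≤ CA^2 := by nlinarith
  have hc4 : 1 ≤ CA^4 := by nlinarith
  have s1 : x * a^2 / CA^4 ≤ x * a^2 := div_le_self (by positivity) hc4
  have s2 : a^2 / (SA^2 * CA^2) ≤ 4 := by
    rw [div_le_iff₀ (by positivity)]
    have : a / 2 ≤ SA := by nlinarith
    have : (a/2)^2 ≤ SA^2 := by gcongr
    have : SA^2 * 1 ≤ SA^2 * CA^2 := by gcongr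
    nlinarith
  have s3 : a^2 * SA^2 / CA^4 ≤ a^2 := by
    rw [div_le_iff₀ (by positivity)]
    have : SA^2 ≤ CA^4 := by nlinarith
    gcongr
  have s2' := mul_le_mul_of_nonneg_right s2 hx0
  have s3' := mul_le_mul_of_nonneg_right s3 hxs
  have s4 : a^2 * (x - s) ≤ a^2 * x := by gcongr; linarith
  have s5 : (1 + 2 * a^2) * x ≤ (1 + 2*a^2) * ε^2 := by gcongr
  have := he2
  nlinarith [mul_nonneg (sq_nonneg a) hx0]

lemma fin_aux {f0 m K B v2 f L Z : ℝ} (z : f0 + m - K * B * v2 ≤ f) (low : K * L ≤ f * Z) :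
    f0 + m + K * (L - B * v2) ≤ f * (1 + Z) := by linarith

/-- pointwise bound -/
lemma Fi_est {a η ε v x s : ℝ} (h : Good a η ε) (hv : |v| ≤ ε) (hs : 0 ≤ s) (hsx : s ≤ x)
    (hx : x ≤ ε ^ 2) :
    sinh a ^ 3 * cosh a + (4 * sinh a ^ 2 + 3) / (4 * sinh a * cosh a) *
        (sinh (a * (1 + v)) ^ 4 - sinh a ^ 4)
      + a ^ 2 * sinh a / cosh a * ((1 - 16 * η) / 2 * (x + sinh a ^ 4 / cosh a ^ 2 * (x - s))
        - (2 + sinh a ^ 2) * v ^ 2) ≤ Fi (2 * a) v x s := by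
  have hS : 0 < sinh a := sinh_pos_iff.2 h.ha
  have hC : 0 < cosh a := cosh_pos a
  have ha := h.ha
  have hη := h.h0
  have hη1 := h.h1
  have hv2 := abs_le.1 (hv.trans h.e1)
  have hA0 : 0 < a * (1 + v) := by nlinarith
  have z := zero_est h hv
  have hx0 : 0 ≤ x := hs.trans hsx
  have hxs : 0 ≤ x - s := by linarith
  have hSA : a * (1 + v) ≤ sinh (a * (1 + v)) := self_le_sinh_iff.2 hA0.le
  have hCA : 1 ≤ cosh (a * (1 + v)) := one_le_cosh _
  have hcsA := cosh_sq (a * (1 + v))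
  have hSA0 : 0 < sinh (a * (1 + v)) := by linarith
  obtain ⟨p, q, hp, hq, e1, e2⟩ := h.pq hv
  obtain ⟨-, -, -, -, b5, b6⟩ := pq_bounds h.h0 h.h1 hp hq
  have q0 : 0 < q := by have := (abs_le.1 hq).1; linarith
  have p0 : 0 < p := by have := (abs_le.1 hp).1; linarith
  have small : x * a^2 / cosh (a*(1+v))^4 + (a^2 / (sinh (a*(1+v))^2 * cosh (a*(1+v))^2) * x
      + a^2 * sinh (a*(1+v))^2 / cosh (a*(1+v))^4 * (x - s)) / 4 ≤ 8 * η := by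
    exact small_aux ha hv2.1 hSA hCA hcsA hSA0 hx0 hs hxs hx h.e2
  have k := Fi_alg (v := v) ha rfl rfl rfl hA0 hs hsx small (by linarith)
  refine le_trans ?_ k
  have low : a ^ 2 * sinh a / cosh a * ((1 - 16 * η) / 2 * (x + sinh a ^ 4 / cosh a ^ 2 * (x - s))) ≤
     sinh (a * (1 + v)) ^ 3 * cosh (a * (1 + v)) *
        ((1 - 8 * η) / 2 *
          (a ^ 2 / (sinh (a * (1 + v)) ^ 2 * cosh (a * (1 + v)) ^ 2) * x +
            a ^ 2 * sinh (a * (1 + v)) ^ 2 / cosh (a * (1 + v)) ^ 4 * (x - s))) := by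
    rw [e1, e2]
    exact low_aux hη hη1 hS hC p0 q0 hx0 hxs b5 b6
  exact fin_aux z low

end FB

namespace FB

lemma cs_abs {u : E → ℝ} (hu : ContinuousOn u SS) :
    (∫ w, |u w| ∂mu) ^ 2 ≤ (∫ w, u w ^ 2 ∂mu) * mu.real Set.univ := by
  have h := real_inner_mul_inner_self_le (cl hu.abs) (cl (continuousOn_const (c := (1:ℝ))))
  rw [inner_cl, inner_cl, inner_cl] at h
  simp only [mul_one, abs_mul_abs_self, integral_const, smul_eq_mul] at h
  simpa only [sq] using h

lemma moment_est {u ψ : E → ℝ} {F : ℝ → ℝ} {κ η ε : ℝ} (hκ : 0 < κ) (hη : 0 < η) (hu : ContinuousOn u SS)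
    (hψ : ContinuousOn ψ SS) (hψ1 : ∀ w ∈ SS, |ψ w| ≤ 1) (hF : Continuous F)
    (hb : ∀ w ∈ SS, |u w| ≤ ε)
    (hest : ∀ v, |v| ≤ ε → |F v - F 0 - κ * v| ≤ κ * (5 * η) * |v|)
    (h0 : ∫ w, (F (u w) - F 0) * ψ w ∂mu = 0) :
    (∫ w, u w * ψ w ∂mu) ^ 2 ≤ 25 * η ^ 2 * (∫ w, u w ^ 2 ∂mu) * mu.real Set.univ := by
  have cF : ContinuousOn (fun w => F (u w)) SS := hF.comp_continuousOn hu
  have i1 : Integrable (fun w => (F (u w) - F 0) * ψ w) mu :=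
    integrable_of_cont ((cF.sub continuousOn_const).mul hψ)
  have i2 : Integrable (fun w => κ * (u w * ψ w)) mu :=
    integrable_of_cont (continuousOn_const.mul (hu.mul hψ))
  have e : κ * ∫ w, u w * ψ w ∂mu = - ∫ w, (F (u w) - F 0 - κ * u w) * ψ w ∂mu := by
    rw [← integral_const_mul]
    have : ∫ w, (F (u w) - F 0 - κ * u w) * ψ w ∂mu =
        ∫ w, (F (u w) - F 0) * ψ w ∂mu - ∫ w, κ * (u w * ψ w) ∂mu := by
      rw [← integral_sub i1 i2]
      congr 1; funext w; ring
    rw [this, h0]; ring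
  have b : |∫ w, (F (u w) - F 0 - κ * u w) * ψ w ∂mu| ≤ ∫ w, κ * (5 * η) * |u w| ∂mu := by
    rw [← Real.norm_eq_abs]
    apply norm_integral_le_of_norm_le (integrable_of_cont (continuousOn_const.mul hu.abs))
    filter_upwards [ae_SS] with w hw
    rw [Real.norm_eq_abs, abs_mul]
    have h1 := hest _ (hb w hw)
    have h2 := hψ1 w hw
    have h3 := mul_le_mul h1 h2 (abs_nonneg _) ((abs_nonneg _).trans h1)
    rwa [mul_one] at h3
  rw [integral_const_mul] at b
  have b2 : κ * |∫ w, u w * ψ w ∂mu| ≤ κ * (5 * η * ∫ w, |u w| ∂mu) := by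
    rw [← abs_of_pos hκ, ← abs_mul, abs_of_pos hκ, e, abs_neg]; linarith
  have b3 := le_of_mul_le_mul_left b2 hκ
  have b4 : (∫ w, u w * ψ w ∂mu) ^ 2 ≤ (5 * η * ∫ w, |u w| ∂mu) ^ 2 := by
    rw [← sq_abs]; gcongr
  have := cs_abs hu
  have : 25 * η^2 * (∫ w, |u w| ∂mu) ^ 2 ≤ 25 * η^2 * ((∫ w, u w ^ 2 ∂mu) * mu.real Set.univ) := by
    gcongr
  nlinarith

lemma Hb_cont (r : ℝ) : Continuous (Hb r) := by
  have hc : Continuous fun σ : ℝ => sinh (σ / 2) ^ 4 := by fun_prop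
  have : Hb r = fun v => ∫ σ in (0:ℝ)..(r * (1 + v)), sinh (σ / 2) ^ 4 := funext (Hb_eq r)
  rw [this]
  have h := intervalIntegral.continuous_primitive (fun a b => hc.intervalIntegrable a b) 0 (μ := volume)
  exact h.comp (by fun_prop)

lemma co_le (w : E) (hw : w ∈ SS) (i : Fin 4) : |co w i| ≤ 1 := by
  have h1 : ‖w‖ ^ 2 = 1 := by rw [mem_sphere_zero_iff_norm.1 hw]; norm_num
  rw [normsq_E] at h1
  fin_cases i <;> simp [co] <;> rw [← sq_le_one_iff_abs_le_one] <;> nlinarith [sq_nonneg (w 0).re, sq_nonneg (w 0).im, sq_nonneg (w 1).re, sq_nonneg (w 1).im]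

lemma co_cont (i : Fin 4) : ContinuousOn (fun w : E => co w i) SS :=
  ((continuous_apply i).comp coL.continuous).continuousOn

lemma co_int (i : Fin 4) : ∫ w, co w i ∂mu = 0 := by
  have := JJ_X i
  rw [JJ_apply] at this
  simpa [pe] using this

lemma Fi_cont {a : ℝ} (ha : 0 < a) {v x s : E → ℝ} (hv : ContinuousOn v SS) (hx : ContinuousOn x SS)
    (hs : ContinuousOn s SS) (hx0 : ∀ w, 0 ≤ x w) (hvb : ∀ w ∈ SS, -1 < v w) :
    ContinuousOn (fun w => Fi (2 * a) (v w) (x w) (s w)) SS := by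
  have ht : ContinuousOn (fun w => tanh (2 * a * (1 + v w) / 2)) SS := by
    have : Continuous tanh := by
      have : tanh = fun x => sinh x / cosh x := funext tanh_eq_sinh_div_cosh
      rw [this]
      exact continuous_sinh.div continuous_cosh (fun x => (cosh_pos x).ne')
    refine this.comp_continuousOn ?_
    fun_prop
  have hpos : ∀ w, 0 < 1 - tanh (2 * a * (1 + v w) / 2) ^ 2 := by
    intro w; rw [one_sub_tanh]; have := cosh_pos (2 * a * (1 + v w) / 2); positivity
  have htp : ∀ w ∈ SS, 0 < tanh (2 * a * (1 + v w) / 2) := by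
    intro w hw
    have h1 := hvb w hw
    rw [tanh_eq_sinh_div_cosh]
    have : 0 < sinh (2 * a * (1 + v w) / 2) := sinh_pos_iff.2 (by
      have : 0 < 1 + v w := by linarith
      positivity)
    have := cosh_pos (2 * a * (1 + v w) / 2)
    positivity
  have hR : ContinuousOn (fun w => 4 / ((2*a) ^ 2 * (1 - tanh (2 * a * (1 + v w) / 2) ^ 2) ^ 2)) SS := by
    refine continuousOn_const.div ?_ ?_
    · exact continuousOn_const.mul ((continuousOn_const.sub (ht.pow 2)).pow 2)
    · intro w _
      have := hpos w
      positivity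
  have hRp : ∀ w, 0 < 4 / ((2*a) ^ 2 * (1 - tanh (2 * a * (1 + v w) / 2) ^ 2) ^ 2) := by
    intro w; have := hpos w; positivity
  unfold Fi
  refine (((ht.pow 3).mul ?_).mul ?_).mul ?_
  · exact (continuousOn_const.sub (ht.pow 2)).rpow_const (fun w _ => Or.inl (hpos w).ne')
  · refine ContinuousOn.sqrt (continuousOn_const.sub ((ht.pow 2).mul ((hR.add hs).div (hR.add hx) ?_)))
    intro w _
    have := hRp w
    have := hx0 w
    positivity
  · refine ContinuousOn.sqrt (continuousOn_const.add (ContinuousOn.div ?_ ?_ ?_))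
    · exact (continuousOn_const.mul ((continuousOn_const.sub (ht.pow 2)).pow 2)).mul hx
    · exact continuousOn_const.mul (ht.pow 2)
    · intro w hw
      have := htp w hw
      positivity

/-- final numeric inequality -/
lemma num_aux {S c η X Y U K : ℝ} (hη : 0 < η) (hη1 : η ≤ 1/1000) (hc : 0 < c) (hcs : c^2 = S^2 + 1)
    (h5 : 61 * η * c^2 ≤ 1) (hU : 0 ≤ U) (hK : K = 25 * η^2 * U) (hX : 8 * (U - 17 * K) ≤ X)
    (hY : 2 * (U - 17 * K) ≤ Y) :
    η * (X + U) ≤ (1 - 16 * η) / 2 * (X + S^4/c^2 * Y) - (2 + S^2) * U := by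
  have hα : S^4/c^2 ≥ S^2 - 1 := by
    rw [ge_iff_le, le_div_iff₀ (by positivity), hcs]; nlinarith
  have hα0 : 0 ≤ S^4/c^2 := by positivity
  have hK1 : (1 - η) * U ≤ U - 17 * K := by
    rw [hK]
    have : 0 ≤ η * U := by positivity
    nlinarith
  have hU1 : 0 ≤ (1 - η) * U := mul_nonneg (by linarith) hU
  have hX1 : 8 * ((1 - η) * U) ≤ X := by linarith
  have hY1 : 2 * ((1 - η) * U) ≤ Y := by linarith
  have hY0 : 0 ≤ Y := by linarith
  set α := S^4/c^2
  have hQ : (6 + 2 * S^2) * ((1 - η) * U) ≤ X + α * Y := by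
    have h1 : α * (2 * ((1 - η) * U)) ≤ α * Y := by gcongr
    have h2 := mul_le_mul_of_nonneg_right (ge_iff_le.1 hα) hU1
    nlinarith
  have hXQ : η * X ≤ η * (X + α * Y) := by
    have : 0 ≤ α * Y := by positivity
    gcongr; linarith
  have h3 : ((1 - 16*η)/2 - η) * ((6 + 2 * S^2) * ((1 - η) * U)) ≤ ((1 - 16*η)/2 - η) * (X + α * Y) := by
    apply mul_le_mul_of_nonneg_left hQ; linarith
  have h4 : (2 + S^2 + η) ≤ ((1 - 16*η)/2 - η) * ((6 + 2 * S^2) * (1 - η)) := by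
    rw [hcs] at h5
    have : (1/2 - 9.5 * η) ≤ ((1 - 16*η)/2 - η) * (1 - η) := by nlinarith
    have : (6 + 2 * S^2) * (1/2 - 9.5 * η) ≤ (6 + 2 * S^2) * (((1 - 16*η)/2 - η) * (1 - η)) := by gcongr
    have : 0 ≤ η * S^2 := by positivity
    nlinarith
  have h6 := mul_le_mul_of_nonneg_right h4 hU
  nlinarith

theorem core {a η ε : ℝ} (h : Good a η ε) (h5 : 61 * η * cosh a ^ 2 ≤ 1) {u : E → ℝ}
    (hu : ContDiffOn ℝ 1 u {0}ᶜ) (hb : ∀ w ∈ SS, |u w| ≤ ε) (hg : ∀ w ∈ SS, ‖gradient u w‖ ≤ ε)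
    (hvol : ∫ w, sinh (a * (1 + u w)) ^ 4 ∂mu = sinh a ^ 4 * mu.real Set.univ)
    (hbar : ∀ i, ∫ w, Hb (2 * a) (u w) * co w i ∂mu = 0) :
    sinh a ^ 3 * cosh a * mu.real Set.univ + a ^ 2 * sinh a / cosh a *
      (η * ∫ w, (‖gradient u w‖ ^ 2 + u w ^ 2) ∂mu) ≤
    ∫ w, Fi (2 * a) (u w) (‖gradient u w‖ ^ 2) (inner ℝ (gradient u w) (Complex.I • w) ^ 2) ∂mu := by
  have hS : 0 < sinh a := sinh_pos_iff.2 h.ha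
  have hC : 0 < cosh a := cosh_pos a
  have ha := h.ha
  have hη := h.h0
  have hc := contOn_SS hu
  have cu2 : ContinuousOn (fun w => u w ^ 2) SS := hc.pow 2
  have cV : ContinuousOn (fun w => sinh (a * (1 + u w)) ^ 4) SS := by fun_prop
  have hgc : ContinuousOn (gradient u) SS := by
    unfold gradient
    exact (InnerProductSpace.toDual ℝ E).symm.continuous.comp_continuousOn (contOn_SS_fderiv hu)
  have cx : ContinuousOn (fun w => ‖gradient u w‖ ^ 2) SS := hgc.norm.pow 2
  have cs : ContinuousOn (fun w => inner ℝ (gradient u w) (Complex.I • w) ^ 2) SS := by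
    refine ContinuousOn.pow (ContinuousOn.inner hgc ?_) 2
    exact q1.continuous.continuousOn
  set U := ∫ w, u w ^ 2 ∂mu with hU
  have hU0 : 0 ≤ U := integral_nonneg (fun w => sq_nonneg _)
  have m0 : (∫ w, u w ∂mu) ^ 2 ≤ 25 * η^2 * U * mu.real Set.univ := by
    have := moment_est (F := fun v => sinh (a * (1 + v)) ^ 4) (ψ := fun _ => 1) (ε := ε)
      (κ := 4 * a * sinh a ^ 3 * cosh a) (η := η) (by positivity) hη hc continuousOn_const (by simp)
      (by fun_prop) hb (fun v hv => by simpa using vol_est h hv) (by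
        simp only [mul_one, add_zero]
        rw [integral_sub (integrable_of_cont cV) (integrable_const _), hvol]
        simp [mul_comm])
    simpa only [mul_one] using this
  have mi : ∀ i, (∫ w, u w * co w i ∂mu) ^ 2 ≤ 25 * η^2 * U * mu.real Set.univ := by
    intro i
    refine moment_est (F := Hb (2 * a)) (ε := ε)
      (κ := 2 * a * sinh a ^ 4) (η := η) (by positivity) hη hc (co_cont i) (fun w hw => co_le w hw i)
      (Hb_cont _) hb (fun v hv => Hb_est h hv) ?_
    simp only [sub_mul]
    have j1 : Integrable (fun w => Hb (2 * a) (u w) * co w i) mu :=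
      integrable_of_cont (((Hb_cont _).comp_continuousOn hc).mul (co_cont i))
    have j2 : Integrable (fun w => Hb (2 * a) 0 * co w i) mu :=
      integrable_of_cont (continuousOn_const.mul (co_cont i))
    rw [integral_sub j1 j2, hbar, integral_const_mul, co_int]
    simp
  obtain ⟨hX, hY⟩ := spectral hu (25 * η^2 * U) (by positivity) m0 mi
  have num := num_aux hη h.h1 hC (cosh_sq a) h5 hU0 rfl hX hY
  set X := ∫ w, ‖gradient u w‖ ^ 2 ∂mu
  set Y := ∫ w, (‖gradient u w‖ ^ 2 - inner ℝ (gradient u w) (Complex.I • w) ^ 2) ∂mu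
  have iX := integrable_of_cont cx
  have iU := integrable_of_cont cu2
  have iY : Integrable (fun w => ‖gradient u w‖ ^ 2 -
      inner ℝ (gradient u w) (Complex.I • w) ^ 2) mu := integrable_of_cont (cx.sub cs)
  have iV := integrable_of_cont cV
  have hsum : ∫ w, (‖gradient u w‖ ^ 2 + u w ^ 2) ∂mu = X + U := integral_add iX iU
  rw [hsum]
  set m := (4 * sinh a ^ 2 + 3) / (4 * sinh a * cosh a)
  set κ := a ^ 2 * sinh a / cosh a
  have hκ : 0 < κ := by positivity
  set α := sinh a ^ 4 / cosh a ^ 2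
  have iF : Integrable (fun w => Fi (2 * a) (u w) (‖gradient u w‖ ^ 2)
      (inner ℝ (gradient u w) (Complex.I • w) ^ 2)) mu := by
    apply integrable_of_cont
    refine Fi_cont ha hc cx cs (fun w => sq_nonneg _) (fun w hw => ?_)
    have := abs_le.1 ((hb w hw).trans h.e1)
    linarith [this.1]
  have iXY : Integrable (fun w => ‖gradient u w‖ ^ 2 + α *
      (‖gradient u w‖ ^ 2 - inner ℝ (gradient u w) (Complex.I • w) ^ 2)) mu :=
    iX.add (iY.const_mul α)
  have iL1 : Integrable (fun w => sinh a ^ 3 * cosh a + m * (sinh (a * (1 + u w)) ^ 4 - sinh a ^ 4)) mu :=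
    (integrable_const _).add ((iV.sub (integrable_const _)).const_mul m)
  have iL2 : Integrable (fun w => κ * ((1 - 16 * η) / 2 * (‖gradient u w‖ ^ 2 + α *
      (‖gradient u w‖ ^ 2 - inner ℝ (gradient u w) (Complex.I • w) ^ 2))
      - (2 + sinh a ^ 2) * u w ^ 2)) mu :=
    ((iXY.const_mul _).sub (iU.const_mul _)).const_mul κ
  have mono : ∫ w, ((sinh a ^ 3 * cosh a + m * (sinh (a * (1 + u w)) ^ 4 - sinh a ^ 4)) +
      κ * ((1 - 16 * η) / 2 * (‖gradient u w‖ ^ 2 + α *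
      (‖gradient u w‖ ^ 2 - inner ℝ (gradient u w) (Complex.I • w) ^ 2))
      - (2 + sinh a ^ 2) * u w ^ 2)) ∂mu ≤
      ∫ w, Fi (2 * a) (u w) (‖gradient u w‖ ^ 2) (inner ℝ (gradient u w) (Complex.I • w) ^ 2) ∂mu := by
    apply integral_mono_ae (iL1.add iL2) iF
    filter_upwards [ae_SS] with w hw
    refine Fi_est h (hb w hw) (sq_nonneg _) ?_ ?_
    · have hbs := bessel (gradient u w) w hw
      rw [q1_apply] at hbs
      nlinarith [sq_nonneg (inner ℝ (gradient u w) (q2 w)), sq_nonneg (inner ℝ (gradient u w) (q3 w))]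
    · have := hg w hw
      gcongr
  refine le_trans ?_ mono
  have p0 : ∫ w, (sinh (a * (1 + u w)) ^ 4 - sinh a ^ 4) ∂mu = 0 := by
    rw [integral_sub iV (integrable_const _), hvol, integral_const, smul_eq_mul]; ring
  have iV1 : Integrable (fun w => m * (sinh (a * (1 + u w)) ^ 4 - sinh a ^ 4)) mu :=
    (iV.sub (integrable_const _)).const_mul m
  have p1 : ∫ w, (sinh a ^ 3 * cosh a + m * (sinh (a * (1 + u w)) ^ 4 - sinh a ^ 4)) ∂mu
      = mu.real Set.univ * (sinh a ^ 3 * cosh a) := by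
    rw [integral_add (integrable_const _) iV1, integral_const_mul m, p0, integral_const, smul_eq_mul]
    ring
  have iY1 : Integrable (fun w => α * (‖gradient u w‖ ^ 2 -
      inner ℝ (gradient u w) (Complex.I • w) ^ 2)) mu := iY.const_mul α
  have p2 : ∫ w, (‖gradient u w‖ ^ 2 + α *
      (‖gradient u w‖ ^ 2 - inner ℝ (gradient u w) (Complex.I • w) ^ 2)) ∂mu = X + α * Y := by
    rw [integral_add iX iY1, integral_const_mul α]
  have iXY1 : Integrable (fun w => (1 - 16 * η) / 2 * (‖gradient u w‖ ^ 2 + α *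
      (‖gradient u w‖ ^ 2 - inner ℝ (gradient u w) (Complex.I • w) ^ 2))) mu := iXY.const_mul _
  have iU1 : Integrable (fun w => (2 + sinh a ^ 2) * u w ^ 2) mu := iU.const_mul _
  have p3 : ∫ w, κ * ((1 - 16 * η) / 2 * (‖gradient u w‖ ^ 2 + α *
      (‖gradient u w‖ ^ 2 - inner ℝ (gradient u w) (Complex.I • w) ^ 2))
      - (2 + sinh a ^ 2) * u w ^ 2) ∂mu =
      κ * ((1 - 16 * η) / 2 * (X + α * Y) - (2 + sinh a ^ 2) * U) := by
    rw [integral_const_mul κ, integral_sub iXY1 iU1, integral_const_mul ((1 - 16 * η) / 2), p2,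
      integral_const_mul (2 + sinh a ^ 2)]
  rw [integral_add iL1 iL2, p1, p3]
  have := mul_le_mul_of_nonneg_left num hκ.le
  linarith

lemma good_exists (r0 : ℝ) (hr0 : 0 < r0) : ∃ η ε : ℝ, 0 < η ∧ 0 < ε ∧ ε ≤ 1/2 ∧
    ∀ a, 0 < a → a ≤ r0 / 2 → Good a η ε ∧ 61 * η * cosh a ^ 2 ≤ 1 := by
  set a0 := r0 / 2 with ha0
  have a0p : 0 < a0 := by positivity
  have hc0 : 1 ≤ cosh a0 := one_le_cosh a0
  have hc02 : 1 ≤ cosh (2 * a0) := one_le_cosh _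
  set L := (1 + a0) * cosh (2 * a0) with hL
  have hL1 : 1 ≤ L := by nlinarith
  set η := 1 / (1000 * cosh a0 ^ 4) with hη
  have c4 : 1 ≤ cosh a0 ^ 4 := one_le_pow₀ hc0
  have η0 : 0 < η := by positivity
  have ηc : 1000 * η * cosh a0 ^ 4 = 1 := by rw [hη]; field_simp
  have η1 : η ≤ 1/1000 := by nlinarith
  set D := (1 + 2 * a0^2) * L with hD
  have hDL : L ≤ D := by nlinarith [sq_nonneg a0]
  have hDa : 1 + 2 * a0^2 ≤ D := by nlinarith [sq_nonneg a0]
  have hD1 : 1 ≤ D := hL1.trans hDL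
  set ε := η / D with hε
  have hεD : ε * D = η := by rw [hε]; field_simp
  have ε0 : 0 < ε := by positivity
  have εη : ε ≤ η := by nlinarith
  refine ⟨η, ε, η0, ε0, by linarith, fun a ha haa => ?_⟩
  have hca : cosh a ≤ cosh a0 := by
    rw [cosh_le_cosh, abs_of_pos ha, abs_of_pos a0p]; exact haa
  have hca1 : 1 ≤ cosh a := one_le_cosh a
  have hca4 : cosh a ^ 4 ≤ cosh a0 ^ 4 := by gcongr
  have hr : ∀ v, |v| ≤ ε → L * |v| ≤ η := by
    intro v hv
    calc L * |v| ≤ D * ε := by gcongr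
      _ = η := by rw [mul_comm]; exact hεD
  have hv2 : ∀ v : ℝ, |v| ≤ ε → |v| ≤ 1/2 := fun v hv => by linarith
  refine ⟨⟨ha, η0, η1, ?_, by linarith, ?_, ?_, ?_⟩, ?_⟩
  · have : η * cosh a ^ 4 ≤ η * cosh a0 ^ 4 := by gcongr
    nlinarith
  · have h1 : (1 + 2 * a^2) * ε ≤ D * ε := by
      have : (1 + 2 * a^2) ≤ 1 + 2 * a0^2 := by gcongr
      gcongr
      linarith
    have h2 : (1 + 2 * a^2) * ε ≤ η := by linarith
    have h3 : (1 + 2 * a^2) * ε * ε ≤ η * 1 := by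
      gcongr
      linarith
    nlinarith
  · exact fun v hv => (ratio_bounds ha haa (hv2 v hv)).1.trans (hr v hv)
  · exact fun v hv => (ratio_bounds ha haa (hv2 v hv)).2.trans (hr v hv)
  · have h1 : cosh a ^ 2 ≤ cosh a ^ 4 := pow_le_pow_right₀ hca1 (by norm_num)
    have : η * cosh a ^ 2 ≤ η * cosh a0 ^ 4 := by gcongr; linarith
    nlinarith

theorem main (r0 : ℝ) (hr0 : 0 < r0) :
    ∃ eps0 c1 : ℝ, 0 < eps0 ∧ eps0 ≤ 1 / 2 ∧ 0 < c1 ∧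
      ∀ (r : ℝ), 0 < r → r ≤ r0 → ∀ u : E → ℝ, ContDiffOn ℝ 1 u {0}ᶜ →
        (∀ w ∈ SS, |u w| ≤ eps0) → (∀ w ∈ SS, ‖gradient u w‖ ≤ eps0) →
        (∫ w, sinh (r * (1 + u w) / 2) ^ 4 ∂mu = sinh (r / 2) ^ 4 * mu.real Set.univ) →
        (∫ w, (Hb r (u w)) • w ∂mu = 0) →
        (∫ w, Fi r (u w) (‖gradient u w‖ ^ 2) (inner ℝ (gradient u w) (Complex.I • w) ^ 2) ∂mu)
          - tanh (r / 2) ^ 3 * ((1 - tanh (r / 2) ^ 2) ^ 2)⁻¹ * mu.real Set.univ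
          ≥ c1 * (tanh (r / 2) ^ 3 * ((1 - tanh (r / 2) ^ 2) ^ 2)⁻¹ * mu.real Set.univ)
            * ∫ w, (‖gradient u w‖ ^ 2 + u w ^ 2) ∂mu := by
  obtain ⟨η, ε, hη, hε, hε2, hgood⟩ := good_exists r0 hr0
  set M := mu.real Set.univ with hM
  have hM0 : 0 ≤ M := measureReal_nonneg
  have hc0 : 0 < cosh (r0 / 2) := cosh_pos _
  refine ⟨ε, η / (cosh (r0/2) ^ 4 * (M + 1)), hε, hε2, by positivity, ?_⟩
  intro r hr hrr u hu hb hg hvol hbar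
  obtain ⟨a, rfl⟩ : ∃ a, r = 2 * a := ⟨r / 2, by ring⟩
  have ha : 0 < a := by linarith
  have haa : a ≤ r0 / 2 := by linarith
  obtain ⟨G, h5⟩ := hgood a ha haa
  have hS : 0 < sinh a := sinh_pos_iff.2 ha
  have hC : 0 < cosh a := cosh_pos a
  have e2 : 2 * a / 2 = a := by ring
  have ev : ∀ v : ℝ, 2 * a * (1 + v) / 2 = a * (1 + v) := fun v => by ring
  simp only [ev, e2] at hvol
  have hbar' : ∀ i, ∫ w, Hb (2 * a) (u w) * co w i ∂mu = 0 := by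
    intro i
    have hintg : Integrable (fun w => Hb (2 * a) (u w) • w) mu :=
      integrable_of_cont (((Hb_cont _).comp_continuousOn (contOn_SS hu)).smul continuousOn_id)
    have := ((ContinuousLinearMap.proj (R := ℝ) (φ := fun _ : Fin 4 => ℝ) i) ∘L coL).integral_comp_comm hintg
    rw [hbar, map_zero] at this
    rw [← this]
    congr 1; funext w
    rw [map_smul]; rfl
  have k := core G h5 hu hb hg hvol hbar'
  have eP : tanh (2 * a / 2) ^ 3 * ((1 - tanh (2 * a / 2) ^ 2) ^ 2)⁻¹ = sinh a ^ 3 * cosh a := by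
    rw [e2, one_sub_tanh, tanh_eq_sinh_div_cosh]; field_simp
  rw [eP]
  set N := ∫ w, (‖gradient u w‖ ^ 2 + u w ^ 2) ∂mu
  have hN : 0 ≤ N := integral_nonneg (fun w => by positivity)
  have hSa : sinh a ≤ a * cosh a := by
    have hd : ∀ x, HasDerivAt (fun x => x * cosh x - sinh x) (x * sinh x) x := by
      intro x
      refine HasDerivAt.congr_deriv (((hasDerivAt_id' x).mul (hasDerivAt_cosh x)).sub (hasDerivAt_sinh x)) ?_
      ring
    have hmono : MonotoneOn (fun x => x * cosh x - sinh x) (Set.Ici 0) := by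
      apply monotoneOn_of_deriv_nonneg (convex_Ici _)
      · exact fun x _ => (hd x).continuousAt.continuousWithinAt
      · exact fun x _ => (hd x).differentiableAt.differentiableWithinAt
      · intro x hx
        rw [interior_Ici] at hx
        rw [(hd x).deriv]
        exact mul_nonneg (le_of_lt hx) (sinh_nonneg_iff.2 (le_of_lt hx))
    have := hmono Set.self_mem_Ici (Set.mem_Ici.2 ha.le) ha.le
    simp at this
    linarith
  have hca : cosh a ≤ cosh (r0/2) := by
    rw [cosh_le_cosh, abs_of_pos ha, abs_of_pos (by positivity)]; exact haa
  have hca4 : cosh a ^ 4 ≤ cosh (r0/2) ^ 4 := by gcongr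
  have key : η / (cosh (r0/2) ^ 4 * (M + 1)) * (sinh a ^ 3 * cosh a * M) ≤
      a ^ 2 * sinh a / cosh a * η := by
    have s1 : sinh a ^ 2 ≤ (a * cosh a) ^ 2 := by gcongr
    have s2 : sinh a ^ 3 * cosh a * cosh a ≤ a ^ 2 * sinh a * cosh (r0/2) ^ 4 := by
      calc sinh a ^ 3 * cosh a * cosh a = sinh a * cosh a ^ 2 * sinh a ^ 2 := by ring
        _ ≤ sinh a * cosh a ^ 2 * (a * cosh a) ^ 2 := by gcongr
        _ = a ^ 2 * sinh a * cosh a ^ 4 := by ring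
        _ ≤ _ := by gcongr
    rw [div_mul_eq_mul_div, div_mul_eq_mul_div, div_le_div_iff₀ (by positivity) hC]
    calc η * (sinh a ^ 3 * cosh a * M) * cosh a = η * (sinh a ^ 3 * cosh a * cosh a) * M := by ring
      _ ≤ η * (a ^ 2 * sinh a * cosh (r0/2) ^ 4) * (M + 1) := by gcongr; linarith
      _ = _ := by ring
  have := mul_le_mul_of_nonneg_right key hN
  linarith

end FB

/-- **Fuglede-type stability theorem for the Bergman ball in ℂ²** (unpacked form).
`u` is given as a degree-0 homogeneous function on `ℂ² \ {0}`, whose restriction to the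
unit sphere `S` is the graph function; `gradient u w` is then the tangential gradient. -/
theorem fuglede_bergman_ball (r0 : ℝ) (hr0 : 0 < r0) :
    ∃ eps0 c1 : ℝ, 0 < eps0 ∧ eps0 ≤ 1 / 2 ∧ 0 < c1 ∧
      ∀ (r : ℝ), 0 < r → r ≤ r0 →
      ∀ u : EuclideanSpace ℂ (Fin 2) → ℝ,
        -- u is determined by its values on the unit sphere (degree-0 homogeneous extension)
        (∀ (c : ℝ), 0 < c → ∀ z : EuclideanSpace ℂ (Fin 2), u (c • z) = u z) →
        -- u is C¹
        ContDiffOn ℝ 1 u {(0 : EuclideanSpace ℂ (Fin 2))}ᶜ →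
        -- ‖u‖_{W^{1,∞}} ≤ eps0
        (∀ w ∈ Metric.sphere (0 : EuclideanSpace ℂ (Fin 2)) 1, |u w| ≤ eps0) →
        (∀ w ∈ Metric.sphere (0 : EuclideanSpace ℂ (Fin 2)) 1, ‖gradient u w‖ ≤ eps0) →
        -- volume constraint  μ(E) = μ(B_r)
        (∫ w in Metric.sphere (0 : EuclideanSpace ℂ (Fin 2)) 1,
            Real.sinh (r * (1 + u w) / 2) ^ 4 ∂μH[3]
          = Real.sinh (r / 2) ^ 4
              * (μH[3] (Metric.sphere (0 : EuclideanSpace ℂ (Fin 2)) 1)).toReal) →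
        -- barycenter constraint (an identity in ℂ²)
        (∫ w in Metric.sphere (0 : EuclideanSpace ℂ (Fin 2)) 1,
            ((1 + u w) * ∫ ρ in (0:ℝ)..r, Real.sinh (ρ * (1 + u w) / 2) ^ 4) • w ∂μH[3]
          = (0 : EuclideanSpace ℂ (Fin 2))) →
        -- conclusion:  P(E) - P(B_r) ≥ c1 · P(B_r) · ‖u‖²_{W^{1,2}}
        (∫ w in Metric.sphere (0 : EuclideanSpace ℂ (Fin 2)) 1,
            Real.tanh (r * (1 + u w) / 2) ^ 3
              * (1 - Real.tanh (r * (1 + u w) / 2) ^ 2) ^ (-(5:ℝ)/2)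
              * Real.sqrt (1 - Real.tanh (r * (1 + u w) / 2) ^ 2
                  * ((4 / (r ^ 2 * (1 - Real.tanh (r * (1 + u w) / 2) ^ 2) ^ 2)
                        + (inner (𝕜 := ℝ) (gradient u w) (Complex.I • w)) ^ 2)
                     / (4 / (r ^ 2 * (1 - Real.tanh (r * (1 + u w) / 2) ^ 2) ^ 2)
                        + ‖gradient u w‖ ^ 2)))
              * Real.sqrt (1 + r ^ 2 * (1 - Real.tanh (r * (1 + u w) / 2) ^ 2) ^ 2
                  * ‖gradient u w‖ ^ 2 / (4 * Real.tanh (r * (1 + u w) / 2) ^ 2)) ∂μH[3])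
          - Real.tanh (r / 2) ^ 3 * ((1 - Real.tanh (r / 2) ^ 2) ^ 2)⁻¹
              * (μH[3] (Metric.sphere (0 : EuclideanSpace ℂ (Fin 2)) 1)).toReal
          ≥ c1 * (Real.tanh (r / 2) ^ 3 * ((1 - Real.tanh (r / 2) ^ 2) ^ 2)⁻¹
                * (μH[3] (Metric.sphere (0 : EuclideanSpace ℂ (Fin 2)) 1)).toReal)
              * ∫ w in Metric.sphere (0 : EuclideanSpace ℂ (Fin 2)) 1,
                  (‖gradient u w‖ ^ 2 + (u w) ^ 2) ∂μH[3] := by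
  obtain ⟨eps0, c1, h0, h1, h2, H⟩ := FB.main r0 hr0
  refine ⟨eps0, c1, h0, h1, h2, ?_⟩
  intro r hr hrr u _ hu hb hg hvol hbar
  have hM : FB.mu.real Set.univ
      = (μH[3] (Metric.sphere (0 : EuclideanSpace ℂ (Fin 2)) 1)).toReal := by
    rw [Measure.real, FB.mu, Measure.restrict_apply_univ]
  have K := H r hr hrr u hu hb hg
  rw [hM] at K
  exact K hvol hbar
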